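/- There exists a universal constant N such that for every classical axisymmetric solution (u,Π) of the 3D Navier–Stokes equations on Q(1) and every 0<R<1, one has sup_{Q(R/2)} |Γ| ≤ N·((1+A(R))/R)^{5/2}·(∬_{Q(R)} Γ² dx dt)^{1/2}. -/

import Mathlib

open Real MeasureTheory Set
open scoped ENNReal
noncomputable section

abbrev E3 := EuclideanSpace ℝ (Fin 3)

/-- `i`-th standard basis vector of `ℝ³`. -/
def ee (i : Fin 3) : E3 := EuclideanSpace.single i 1

/-- partial derivative of a scalar function in the direction `eᵢ`. -/
def pd (f : E3 → ℝ) (i : Fin 3) (x : E3) : ℝ := fderiv ℝ f x (ee i)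

/-- Laplacian of a scalar function. -/
def lap (f : E3 → ℝ) (x : E3) : ℝ := ∑ i, pd (fun y => pd f i y) i x

/-- parabolic cylinder `Q(z₀,R) = B(x₀,R) × (t₀ - R², t₀)`. -/
def Qyl (z₀ : E3 × ℝ) (R : ℝ) : Set (E3 × ℝ) :=
  (Metric.ball z₀.1 R) ×ˢ (Ioo (z₀.2 - R ^ 2) z₀.2)

/-- `(u, P)` is a classical solution of the 3D Navier–Stokes equations on the open set `U`,
which contains the closure of `Q(1)`. -/
structure IsNSQ1 (u : E3 → ℝ → E3) (P : E3 → ℝ → ℝ) (U : Set (E3 × ℝ)) : Prop where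
  open_U : IsOpen U
  subset_U : closure (Qyl (0, 0) 1) ⊆ U
  smooth_u : ContDiffOn ℝ (⊤ : ℕ∞) (fun z : E3 × ℝ => u z.1 z.2) U
  smooth_P : ContDiffOn ℝ (⊤ : ℕ∞) (fun z : E3 × ℝ => P z.1 z.2) U
  momentum : ∀ x : E3, ∀ t : ℝ, (x, t) ∈ U → ∀ j : Fin 3,
    deriv (fun s => u x s j) t
      + (∑ i, u x t i * pd (fun y => u y t j) i x)
      - lap (fun y => u y t j) x
      + pd (fun y => P y t) j x = 0
  divfree : ∀ x : E3, ∀ t : ℝ, (x, t) ∈ U → ∑ i, pd (fun y => u y t i) i x = 0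

/-- `(u, P)` is axially symmetric on `U`: in cylindrical coordinates
`u = uʳ eᵣ + uᶿ e_θ + u³ e₃` and `P = p(r, x₃, t)`. -/
def IsAxisym (u : E3 → ℝ → E3) (P : E3 → ℝ → ℝ) (U : Set (E3 × ℝ)) : Prop :=
  ∃ ur uθ u3 pp : ℝ → ℝ → ℝ → ℝ,
    ∀ x : E3, ∀ t : ℝ, (x, t) ∈ U → x 0 ^ 2 + x 1 ^ 2 ≠ 0 →
      u x t 0 = ur (Real.sqrt (x 0 ^ 2 + x 1 ^ 2)) (x 2) t
                  * (x 0 / Real.sqrt (x 0 ^ 2 + x 1 ^ 2))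
                - uθ (Real.sqrt (x 0 ^ 2 + x 1 ^ 2)) (x 2) t
                  * (x 1 / Real.sqrt (x 0 ^ 2 + x 1 ^ 2)) ∧
      u x t 1 = ur (Real.sqrt (x 0 ^ 2 + x 1 ^ 2)) (x 2) t
                  * (x 1 / Real.sqrt (x 0 ^ 2 + x 1 ^ 2))
                + uθ (Real.sqrt (x 0 ^ 2 + x 1 ^ 2)) (x 2) t
                  * (x 0 / Real.sqrt (x 0 ^ 2 + x 1 ^ 2)) ∧
      u x t 2 = u3 (Real.sqrt (x 0 ^ 2 + x 1 ^ 2)) (x 2) t ∧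
      P x t = pp (Real.sqrt (x 0 ^ 2 + x 1 ^ 2)) (x 2) t

/-- `Γ = r uᶿ = x₁ u₂ - x₂ u₁`. -/
def Gam (u : E3 → ℝ → E3) (x : E3) (t : ℝ) : ℝ := x 0 * u x t 1 - x 1 * u x t 0

/-- Cartesian components of `b = uʳ eᵣ + u³ e₃ = u - uᶿ e_θ`. -/
def bcomp (u : E3 → ℝ → E3) (x : E3) (t : ℝ) : Fin 3 → ℝ :=
  ![u x t 0 + x 1 * Gam u x t / (x 0 ^ 2 + x 1 ^ 2),
    u x t 1 - x 0 * Gam u x t / (x 0 ^ 2 + x 1 ^ 2),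
    u x t 2]

/-- Euclidean norm of `b`. -/
def bnorm (u : E3 → ℝ → E3) (x : E3) (t : ℝ) : ℝ :=
  Real.sqrt (∑ i, (bcomp u x t i) ^ 2)

/-- `A(z₀,R)`. -/
def AA (u : E3 → ℝ → E3) (z₀ : E3 × ℝ) (R : ℝ) : ℝ :=
  ⨆ t ∈ Ioo (z₀.2 - R ^ 2) z₀.2, R⁻¹ * ∫ x in Metric.ball z₀.1 R, ‖u x t‖ ^ 2

/-- `E(z₀,R)`. -/
def EE (u : E3 → ℝ → E3) (z₀ : E3 × ℝ) (R : ℝ) : ℝ :=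
  R⁻¹ * ∫ t in Ioo (z₀.2 - R ^ 2) z₀.2, ∫ x in Metric.ball z₀.1 R,
    ∑ j, ∑ i, (pd (fun y => u y t j) i x) ^ 2

/-- `C(z₀,R)`. -/
def CC (u : E3 → ℝ → E3) (z₀ : E3 × ℝ) (R : ℝ) : ℝ :=
  (R ^ 2)⁻¹ * ∫ t in Ioo (z₀.2 - R ^ 2) z₀.2, ∫ x in Metric.ball z₀.1 R, ‖u x t‖ ^ 3

/-- `D(z₀,R)`. -/
def DD (P : E3 → ℝ → ℝ) (z₀ : E3 × ℝ) (R : ℝ) : ℝ :=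
  (R ^ 2)⁻¹ * ∫ t in Ioo (z₀.2 - R ^ 2) z₀.2, ∫ x in Metric.ball z₀.1 R, |P x t| ^ (3/2 : ℝ)

/-- `𝓔(z₀,R) = A + E + D`. -/
def EEE (u : E3 → ℝ → E3) (P : E3 → ℝ → ℝ) (z₀ : E3 × ℝ) (R : ℝ) : ℝ :=
  AA u z₀ R + EE u z₀ R + DD P z₀ R

/-- the weight `ω(R) = (ln ln (100/R))⁻¹`. -/
def omg (R : ℝ) : ℝ := (Real.log (Real.log (100 / R)))⁻¹

/-- `G(z₀,R) = R^{1-3/p-2/q} ‖b‖_{L^{p,q}(Q(z₀,R))}` (space norm `Lᵖ`, time norm `L^q`). -/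
def Gfun (u : E3 → ℝ → E3) (p q : ℝ≥0∞) (z₀ : E3 × ℝ) (R : ℝ) : ℝ :=
  R ^ (1 - 3 / p.toReal - 2 / q.toReal) *
    (eLpNorm (fun t =>
        (eLpNorm (fun x => bnorm u x t) p (volume.restrict (Metric.ball z₀.1 R))).toReal)
      q (volume.restrict (Ioo (z₀.2 - R ^ 2) z₀.2))).toReal

/-- `m_R = inf_{Q(R)} Γ`. -/
def mR (u : E3 → ℝ → E3) (R : ℝ) : ℝ :=
  sInf ((fun z : E3 × ℝ => Gam u z.1 z.2) '' Qyl (0, 0) R)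

/-- `M_R = sup_{Q(R)} Γ`. -/
def MMR (u : E3 → ℝ → E3) (R : ℝ) : ℝ :=
  sSup ((fun z : E3 × ℝ => Gam u z.1 z.2) '' Qyl (0, 0) R)

/-- `J_R = M_R - m_R`. -/
def JR (u : E3 → ℝ → E3) (R : ℝ) : ℝ := MMR u R - mR u R

/-- the normalized function `h`. -/
def hfun (u : E3 → ℝ → E3) (R : ℝ) (x : E3) (t : ℝ) : ℝ :=
  if -(mR u R) < MMR u R then 2 * (MMR u R - Gam u x t) / JR u R
  else 2 * (Gam u x t - mR u R) / JR u R

/-- oscillation of `Γ` over `Q(z₀,R)`. -/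
def oscΓ (u : E3 → ℝ → E3) (z₀ : E3 × ℝ) (R : ℝ) : ℝ :=
  sSup ((fun z : E3 × ℝ => Gam u z.1 z.2) '' Qyl z₀ R) -
    sInf ((fun z : E3 × ℝ => Gam u z.1 z.2) '' Qyl z₀ R)

theorem hasDerivAt_max_zero_pow (n : ℕ) (s : ℝ) :
    HasDerivAt (fun s : ℝ => max s 0 ^ (n + 2)) ((n + 2) * max s 0 ^ (n + 1)) s := by
  rcases lt_trichotomy s 0 with h | rfl | h
  · rw [max_eq_right h.le]
    have : (fun s : ℝ => max s 0 ^ (n + 2)) =ᶠ[nhds s] fun _ => 0 := by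
      filter_upwards [eventually_lt_nhds h] with y hy
      simp [max_eq_right hy.le]
    simpa using (hasDerivAt_const s (0 : ℝ)).congr_of_eventuallyEq this
  · have hd : HasDerivAt (fun s : ℝ => |s| ^ (n + 2)) 0 0 := by
      rw [hasDerivAt_iff_isLittleO]
      simp only [abs_zero, ne_eq, Nat.add_eq_zero_iff, OfNat.ofNat_ne_zero, and_false,
        not_false_eq_true, zero_pow, sub_zero, smul_eq_mul, mul_zero]
      rw [Asymptotics.isLittleO_iff]
      intro c hc
      filter_upwards [Metric.ball_mem_nhds (0 : ℝ) (lt_min hc one_pos)] with y hy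
      rw [Metric.mem_ball, dist_zero_right, Real.norm_eq_abs, lt_min_iff] at hy
      rw [Real.norm_eq_abs, Real.norm_eq_abs, abs_of_nonneg (by positivity), pow_succ]
      gcongr
      calc |y| ^ (n + 1) ≤ |y| ^ 1 :=
            pow_le_pow_of_le_one (abs_nonneg y) hy.2.le (by omega)
        _ ≤ c := by simpa using hy.1.le
    have : HasDerivAt (fun s : ℝ => max s 0 ^ (n + 2)) 0 0 := by
      rw [hasDerivAt_iff_isLittleO] at hd ⊢
      simp only [abs_zero, ne_eq, Nat.add_eq_zero_iff, OfNat.ofNat_ne_zero, and_false,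
        not_false_eq_true, zero_pow, sub_zero, smul_eq_mul, mul_zero, max_self] at hd ⊢
      refine Asymptotics.IsBigO.trans_isLittleO ?_ hd
      refine Asymptotics.isBigO_of_le _ fun y => ?_
      rw [norm_pow, norm_pow, Real.norm_eq_abs, Real.norm_eq_abs, abs_abs]
      refine pow_le_pow_left₀ (abs_nonneg _) ?_ _
      rw [abs_of_nonneg (le_max_right _ _)]
      exact max_le (le_abs_self y) (abs_nonneg y)
    simpa using this
  · rw [max_eq_left h.le]
    have : (fun s : ℝ => max s 0 ^ (n + 2)) =ᶠ[nhds s] fun s => s ^ (n + 2) := by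
      filter_upwards [eventually_gt_nhds h] with y hy
      rw [max_eq_left (le_of_lt hy)]
    simpa using (hasDerivAt_pow (n + 2) s).congr_of_eventuallyEq this

/-- A regularized truncation: `F` is a `C²` function vanishing below the level `k`, comparable to
`(s - k)₊` in the sense of `le_trunc` and `trunc_sq_le`, whose square is convex in the
quantitative form `F'² ≤ (F²)''`. -/
structure Truncation (k δ : ℝ) (F F1 F2 : ℝ → ℝ) : Prop where
  deriv : ∀ s, HasDerivAt F (F1 s) s
  deriv1 : ∀ s, HasDerivAt F1 (F2 s) s
  cont2 : Continuous F2
  nonneg : ∀ s, 0 ≤ F s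
  zero : ∀ s ≤ k, F s = 0
  zero1 : ∀ s ≤ k, F1 s = 0
  zero2 : ∀ s ≤ k, F2 s = 0
  le_trunc : ∀ s, F s ≤ max (s - k) 0
  convex_sq : ∀ s, 0 ≤ F1 s ^ 2 + 2 * F s * F2 s
  trunc_sq_le : ∀ s, max (s - (k + δ)) 0 ^ 2 ≤ 2 / δ * F s ^ 3

theorem exists_truncation_unit : ∃ F F1 F2, Truncation 0 1 F F1 F2 := by
  have hp : ∀ s : ℝ, 0 < 1 + s ^ 2 := fun s => by positivity
  have hs : ∀ s : ℝ, s ≤ 0 ∧ max s 0 = 0 ∨ 0 < s ∧ max s 0 = s := fun s => by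
    rcases le_or_gt s 0 with h | h
    · exact Or.inl ⟨h, max_eq_right h⟩
    · exact Or.inr ⟨h, max_eq_left h.le⟩
  refine ⟨fun s => max s 0 ^ 3 / (1 + s ^ 2),
    fun s => (max s 0 ^ 4 + 3 * max s 0 ^ 2) / (1 + s ^ 2) ^ 2,
    fun s => ((4 * max s 0 ^ 3 + 6 * max s 0) * (1 + s ^ 2) -
      4 * s * (max s 0 ^ 4 + 3 * max s 0 ^ 2)) / (1 + s ^ 2) ^ 3, ?_⟩
  constructor
  · intro s
    have h := (hasDerivAt_max_zero_pow 1 s).div (((hasDerivAt_id s).pow 2).const_add 1) (hp s).ne'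
    refine HasDerivAt.congr_deriv h ?_
    have := (hp s).ne'
    rcases hs s with ⟨_, h⟩ | ⟨_, h⟩ <;> simp [h]
    field_simp
    ring
  · intro s
    have h := ((hasDerivAt_max_zero_pow 2 s).add ((hasDerivAt_max_zero_pow 0 s).const_mul 3)).div
      ((((hasDerivAt_id s).pow 2).const_add 1).pow 2) (pow_pos (hp s) 2).ne'
    refine HasDerivAt.congr_deriv h ?_
    have := (hp s).ne'
    simp
    field_simp
    ring
  · exact Continuous.div (by fun_prop) (by fun_prop) fun s => (pow_pos (hp s) 3).ne'
  · intro s; have := hp s; positivity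
  · intro s h; simp [max_eq_right h]
  · intro s h; simp [max_eq_right h]
  · intro s h; simp [max_eq_right h]
  · intro s
    have := hp s
    rw [sub_zero, div_le_iff₀ this]
    rcases hs s with ⟨_, h⟩ | ⟨h0, h⟩ <;> rw [h] <;> nlinarith
  · intro s
    have := hp s
    rcases hs s with ⟨_, h⟩ | ⟨h0, h⟩ <;> simp only [h]
    · simp
    · have e : ((s ^ 4 + 3 * s ^ 2) / (1 + s ^ 2) ^ 2) ^ 2 + 2 * (s ^ 3 / (1 + s ^ 2)) *
          (((4 * s ^ 3 + 6 * s) * (1 + s ^ 2) - 4 * s * (s ^ 4 + 3 * s ^ 2)) / (1 + s ^ 2) ^ 3) =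
          s ^ 4 * ((s ^ 2 + 3) ^ 2 + 4 * (3 - s ^ 2)) / (1 + s ^ 2) ^ 4 := by
        field_simp
        ring
      rw [e]
      have : 0 ≤ (s ^ 2 + 3) ^ 2 + 4 * (3 - s ^ 2) := by nlinarith [sq_nonneg (s ^ 2)]
      positivity
  · intro s
    have := hp s
    rcases le_or_gt s 1 with h | h
    · rw [max_eq_right (by linarith), zero_pow two_ne_zero]
      have : 0 ≤ max s 0 := le_max_right _ _
      positivity
    · rw [max_eq_left (by linarith), max_eq_left (by linarith)]
      have h1 : s - 1 ≤ s ^ 3 / (1 + s ^ 2) := by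
        rw [le_div_iff₀ this]; nlinarith
      have h2 : 1 / 2 ≤ s ^ 3 / (1 + s ^ 2) := by
        rw [le_div_iff₀ this]; nlinarith [mul_pos (sub_pos.2 h) (sub_pos.2 h), sq_nonneg s]
      set w := s ^ 3 / (1 + s ^ 2)
      nlinarith [mul_nonneg (sub_nonneg.2 h2) (sq_nonneg w)]

theorem exists_truncation (k : ℝ) {δ : ℝ} (hδ : 0 < δ) : ∃ F F1 F2, Truncation k δ F F1 F2 := by
  obtain ⟨F, F1, F2, h⟩ := exists_truncation_unit
  have hd : ∀ s, HasDerivAt (fun s => (s - k) / δ) (1 / δ) s := fun s =>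
    ((hasDerivAt_id s).sub_const k).div_const δ
  have hle : ∀ s ≤ k, (s - k) / δ ≤ 0 := fun s hs =>
    div_nonpos_of_nonpos_of_nonneg (by linarith) hδ.le
  have hmax : ∀ s, δ * max s 0 = max (δ * s) 0 := fun s => by
    rw [mul_max_of_nonneg _ _ hδ.le, mul_zero]
  refine ⟨fun s => δ * F ((s - k) / δ), fun s => F1 ((s - k) / δ),
    fun s => F2 ((s - k) / δ) / δ, ?_⟩
  constructor
  · intro s
    refine HasDerivAt.congr_deriv (((h.deriv ((s - k) / δ)).comp s (hd s)).const_mul δ) ?_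
    field_simp
  · intro s
    refine HasDerivAt.congr_deriv ((h.deriv1 ((s - k) / δ)).comp s (hd s)) ?_
    ring
  · exact (h.cont2.comp (by fun_prop)).div_const δ
  · exact fun s => mul_nonneg hδ.le (h.nonneg _)
  · exact fun s hs => by simp [h.zero _ (hle s hs)]
  · exact fun s hs => h.zero1 _ (hle s hs)
  · exact fun s hs => by simp [h.zero2 _ (hle s hs)]
  · intro s
    have := mul_le_mul_of_nonneg_left (h.le_trunc ((s - k) / δ)) hδ.le
    rwa [hmax, sub_zero, mul_div_cancel₀ _ hδ.ne'] at this
  · intro s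
    convert h.convex_sq ((s - k) / δ) using 1
    field_simp
  · intro s
    have h1 := mul_le_mul_of_nonneg_left (h.trunc_sq_le ((s - k) / δ)) (sq_nonneg δ)
    rw [← mul_pow, hmax] at h1
    have e : δ * ((s - k) / δ - (0 + 1)) = s - (k + δ) := by field_simp; ring
    rw [e] at h1
    refine h1.trans (le_of_eq ?_)
    field_simp

theorem norm_sq_le_sum_apply_ee (L : E3 →L[ℝ] ℝ) : ‖L‖ ^ 2 ≤ ∑ i, L (ee i) ^ 2 := by
  have h0 : 0 ≤ ∑ i, L (ee i) ^ 2 := Finset.sum_nonneg fun i _ => sq_nonneg _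
  have h1 : ‖L‖ ≤ √(∑ i, L (ee i) ^ 2) := by
    refine L.opNorm_le_bound (Real.sqrt_nonneg _) fun v => ?_
    have hv : L v = ∑ i, v i * L (ee i) := by
      conv_lhs => rw [← (EuclideanSpace.basisFun (Fin 3) ℝ).sum_repr v]
      simp [ee]
    rw [hv, Real.norm_eq_abs, EuclideanSpace.norm_eq, ← Real.sqrt_mul h0]
    refine Real.abs_le_sqrt ?_
    rw [mul_comm]
    simpa using Finset.sum_mul_sq_le_sq_mul_sq Finset.univ (fun i => v i) fun i => L (ee i)
  calc ‖L‖ ^ 2 ≤ √(∑ i, L (ee i) ^ 2) ^ 2 := pow_le_pow_left₀ (norm_nonneg _) h1 2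
    _ = _ := Real.sq_sqrt h0

theorem integrable_of_eq_zero_off_closedBall {f : E3 → ℝ} (hf : Continuous f) {R : ℝ}
    (h : ∀ x, R < ‖x‖ → f x = 0) : Integrable f := by
  refine hf.integrable_of_hasCompactSupport
    (HasCompactSupport.intro (isCompact_closedBall (0 : E3) R) fun x hx => h x ?_)
  simpa using hx

theorem integral_eq_setIntegral_closedBall {f : E3 → ℝ} {R : ℝ}
    (h : ∀ x, R < ‖x‖ → f x = 0) : ∫ x, f x = ∫ x in Metric.closedBall 0 R, f x := by
  refine (setIntegral_eq_integral_of_forall_compl_eq_zero fun x hx => h x ?_).symm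
  simpa using hx

theorem continuous_pd {g : E3 → ℝ} (hg : ContDiff ℝ 1 g) (i : Fin 3) : Continuous (pd g i) :=
  (hg.continuous_fderiv (by norm_num)).clm_apply continuous_const

theorem fderiv_eq_zero_off_closedBall {g : E3 → ℝ} {R : ℝ} (h : ∀ x, R < ‖x‖ → g x = 0) (x : E3)
    (hx : R < ‖x‖) : fderiv ℝ g x = 0 := by
  have : g =ᶠ[nhds x] fun _ => 0 := by
    filter_upwards [continuous_norm.continuousAt.eventually (eventually_gt_nhds hx)] with y hy
      using h y hy
  rw [this.fderiv_eq]
  simp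

theorem pd_eq_zero_off_closedBall {g : E3 → ℝ} {R : ℝ} (h : ∀ x, R < ‖x‖ → g x = 0) (i : Fin 3)
    (x : E3) (hx : R < ‖x‖) : pd g i x = 0 := by
  simp [pd, fderiv_eq_zero_off_closedBall h x hx]

theorem integral_pd_eq_zero {g : E3 → ℝ} (hg : ContDiff ℝ 1 g) {R : ℝ}
    (h : ∀ x, R < ‖x‖ → g x = 0) (i : Fin 3) : ∫ x, pd g i x = 0 := by
  have i1 := integrable_of_eq_zero_off_closedBall (continuous_pd hg i)
    (pd_eq_zero_off_closedBall h i)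
  have i2 := integrable_of_eq_zero_off_closedBall hg.continuous h
  have := integral_mul_fderiv_eq_neg_fderiv_mul_of_integrable (μ := (volume : Measure E3))
    (f := fun _ => (1 : ℝ)) (g := g) (v := ee i) (by simp)
    (by simp only [one_mul]; exact i1)
    (by simp only [one_mul]; exact i2) (by fun_prop)
    (fun x _ => hg.differentiable (by norm_num) x)
  simpa [pd] using this

theorem sobolev_inequality : ∃ C : ℝ, 0 < C ∧ ∀ (g : E3 → ℝ) (R : ℝ), ContDiff ℝ 1 g →
    (∀ x, R < ‖x‖ → g x = 0) → ∫ x, g x ^ 6 ≤ C * (∫ x, ∑ i, pd g i x ^ 2) ^ 3 := by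
  set c : NNReal := SNormLESNormFDerivOfEqConst ℝ (volume : Measure E3) (2 : NNReal) with hc
  refine ⟨(c : ℝ) ^ 6 + 1, by positivity, fun g R hg h => ?_⟩
  have hs : HasCompactSupport g :=
    HasCompactSupport.intro (isCompact_closedBall (0 : E3) R) fun x hx => h x (by simpa using hx)
  have hdim : Module.finrank ℝ E3 = 3 := by simp
  have key := eLpNorm_le_eLpNorm_fderiv_of_eq (volume : Measure E3) (u := g) hg hs (p := 2)
    (p' := 6) (by norm_num) (by rw [hdim]; norm_num) (by rw [hdim]; norm_num)
  have hdc : Continuous (fderiv ℝ g) := hg.continuous_fderiv (by norm_num)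
  have m1 : MemLp g 6 (volume : Measure E3) := hg.continuous.memLp_of_hasCompactSupport hs
  have m2 : MemLp (fderiv ℝ g) 2 (volume : Measure E3) :=
    hdc.memLp_of_hasCompactSupport (hs.fderiv (𝕜 := ℝ))
  rw [← hc] at key
  simp only [ENNReal.coe_ofNat] at key
  rw [m1.eLpNorm_eq_integral_rpow_norm (by norm_num) (by norm_num),
    m2.eLpNorm_eq_integral_rpow_norm (by norm_num) (by norm_num)] at key
  have hS : ∫ x, ‖fderiv ℝ g x‖ ^ 2 ≤ ∫ x, ∑ i, pd g i x ^ 2 := by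
    refine integral_mono ?_ ?_ fun x => norm_sq_le_sum_apply_ee _
    · exact integrable_of_eq_zero_off_closedBall (hdc.norm.pow 2) (R := R) fun x hx => by
        simp [fderiv_eq_zero_off_closedBall h x hx]
    · refine integrable_finsetSum _ fun i _ => ?_
      exact integrable_of_eq_zero_off_closedBall ((continuous_pd hg i).pow 2) (R := R) fun x hx => by
        simp [pd_eq_zero_off_closedBall h i x hx]
  have e1 : ∫ x, ‖g x‖ ^ (ENNReal.toReal 6) = ∫ x, g x ^ 6 := by
    refine integral_congr_ae (Filter.Eventually.of_forall fun x => ?_)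
    have : ENNReal.toReal 6 = ((6 : ℕ) : ℝ) := by simp
    simp only [this, Real.rpow_natCast, Real.norm_eq_abs]
    exact Even.pow_abs (by decide) _
  have e2 : ∫ x, ‖fderiv ℝ g x‖ ^ (ENNReal.toReal 2) = ∫ x, ‖fderiv ℝ g x‖ ^ 2 := by
    refine integral_congr_ae (Filter.Eventually.of_forall fun x => ?_)
    have : ENNReal.toReal 2 = ((2 : ℕ) : ℝ) := by simp
    simp only [this, Real.rpow_natCast]
  rw [e1, e2] at key
  have p1 : 0 ≤ ∫ x, g x ^ 6 := integral_nonneg fun x => by positivity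
  have p2 : 0 ≤ ∫ x, ‖fderiv ℝ g x‖ ^ 2 := integral_nonneg fun x => by positivity
  set a := ∫ x, g x ^ 6
  set b := ∫ x, ‖fderiv ℝ g x‖ ^ 2
  rw [← ENNReal.ofReal_coe_nnreal, ← ENNReal.ofReal_mul c.coe_nonneg,
    ENNReal.ofReal_le_ofReal_iff (by positivity)] at key
  have k6 := pow_le_pow_left₀ (by positivity) key 6
  have ea : (a ^ (ENNReal.toReal 6)⁻¹) ^ 6 = a := by
    rw [← Real.rpow_natCast, ← Real.rpow_mul p1]; simp
  have eb : (b ^ (ENNReal.toReal 2)⁻¹) ^ 6 = b ^ 3 := by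
    rw [← Real.rpow_natCast, ← Real.rpow_natCast, ← Real.rpow_mul p2]; norm_num
  rw [mul_pow, ea, eb] at k6
  calc a ≤ (c : ℝ) ^ 6 * b ^ 3 := k6
    _ ≤ ((c : ℝ) ^ 6 + 1) * b ^ 3 := by gcongr; linarith
    _ ≤ _ := by gcongr

/-- Cauchy–Schwarz for integrable functions. -/
theorem sq_integral_mul_le {α : Type*} [MeasurableSpace α] {μ : Measure α} {f g : α → ℝ}
    (hf : Integrable (fun x => f x ^ 2) μ) (hg : Integrable (fun x => g x ^ 2) μ)
    (hfg : Integrable (fun x => f x * g x) μ) :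
    (∫ x, f x * g x ∂μ) ^ 2 ≤ (∫ x, f x ^ 2 ∂μ) * ∫ x, g x ^ 2 ∂μ := by
  have h : ∀ t : ℝ, 0 ≤ (∫ x, g x ^ 2 ∂μ) * (t * t) + (2 * ∫ x, f x * g x ∂μ) * t +
      ∫ x, f x ^ 2 ∂μ := fun t => by
    have : 0 ≤ ∫ x, (g x ^ 2 * (t * t) + (2 * (f x * g x)) * t + f x ^ 2) ∂μ :=
      integral_nonneg fun x => by
        have : g x ^ 2 * (t * t) + (2 * (f x * g x)) * t + f x ^ 2 = (f x + t * g x) ^ 2 := by ring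
        simp only [Pi.zero_apply, this]
        positivity
    have hi : Integrable (fun x => g x ^ 2 * (t * t) + (2 * (f x * g x)) * t) μ :=
      (hg.mul_const _).add ((hfg.const_mul 2).mul_const t)
    rwa [integral_add hi hf, integral_add (hg.mul_const _) ((hfg.const_mul 2).mul_const t), integral_mul_const,
      integral_mul_const, integral_const_mul] at this
  have := discrim_le_zero h
  rw [discrim] at this
  nlinarith

/-- A form of Young's inequality with exponents `4` and `4/3`. -/
theorem le_add_of_pow_four_le {w a b : ℝ} (ha : 0 ≤ a) (hb : 0 ≤ b)
    (h : w ^ 4 ≤ 4 * a ^ 3 * b) : w ≤ a + b := by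
  refine le_of_pow_le_pow_left₀ (n := 4) (by norm_num) (by positivity) (h.trans ?_)
  have : 0 ≤ a ^ 4 + 6 * a ^ 2 * b ^ 2 + 4 * a * b ^ 3 + b ^ 4 := by positivity
  nlinarith

/-- `f` is differentiable at `x` with `i`-th partial derivative `f'`. -/
def HasPd (f : E3 → ℝ) (f' : ℝ) (i : Fin 3) (x : E3) : Prop :=
  DifferentiableAt ℝ f x ∧ pd f i x = f'

namespace HasPd

variable {f g : E3 → ℝ} {f' g' : ℝ} {i : Fin 3} {x : E3}

theorem of_differentiableAt (h : DifferentiableAt ℝ f x) : HasPd f (pd f i x) i x := ⟨h, rfl⟩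

theorem add (hf : HasPd f f' i x) (hg : HasPd g g' i x) :
    HasPd (fun y => f y + g y) (f' + g') i x := by
  refine ⟨hf.1.add hg.1, ?_⟩
  rw [← hf.2, ← hg.2, pd, fderiv_fun_add hf.1 hg.1]
  rfl

theorem sub (hf : HasPd f f' i x) (hg : HasPd g g' i x) :
    HasPd (fun y => f y - g y) (f' - g') i x := by
  refine ⟨hf.1.sub hg.1, ?_⟩
  rw [← hf.2, ← hg.2, pd, fderiv_fun_sub hf.1 hg.1]
  rfl

theorem mul (hf : HasPd f f' i x) (hg : HasPd g g' i x) :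
    HasPd (fun y => f y * g y) (f' * g x + f x * g') i x := by
  refine ⟨hf.1.mul hg.1, ?_⟩
  rw [← hf.2, ← hg.2, pd, fderiv_fun_mul hf.1 hg.1]
  simp [pd]
  ring

theorem comp {c : ℝ → ℝ} {c' : ℝ} (hc : HasDerivAt c c' (f x)) (hf : HasPd f f' i x) :
    HasPd (fun y => c (f y)) (c' * f') i x := by
  have h := hc.comp_hasFDerivAt x hf.1.hasFDerivAt
  refine ⟨h.differentiableAt, ?_⟩
  rw [← hf.2, pd, show (fun y => c (f y)) = c ∘ f from rfl, h.fderiv]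
  simp [pd]

theorem const (c : ℝ) : HasPd (fun _ => c) 0 i x := by
  refine ⟨by fun_prop, ?_⟩
  simp [pd]

theorem coord (j : Fin 3) : HasPd (fun y => y j) (if j = i then 1 else 0) i x := by
  refine ⟨by fun_prop, ?_⟩
  have : (fun y : E3 => y j) = (EuclideanSpace.proj j : E3 →L[ℝ] ℝ) := rfl
  rw [pd, this, ContinuousLinearMap.fderiv]
  simp [ee]

theorem norm_sq : HasPd (fun y => ‖y‖ ^ 2) (2 * x i) i x := by
  have h : HasPd (fun y : E3 => y 0 * y 0 + y 1 * y 1 + y 2 * y 2)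
      (2 * x i) i x := by
    have := (((coord (i := i) (x := x) 0).mul (coord 0)).add ((coord 1).mul (coord 1))).add
      ((coord 2).mul (coord 2))
    refine ⟨this.1, this.2.trans ?_⟩
    fin_cases i <;> simp <;> ring
  convert h using 2 with y
  rw [EuclideanSpace.norm_sq_eq, Fin.sum_univ_three]
  simp only [Real.norm_eq_abs, sq_abs]
  ring

end HasPd

/-- The unnormalized spatial cutoff `(ρ² - |x|²)₊`. -/
def cutoff (ρ : ℝ) (x : E3) : ℝ := max (ρ ^ 2 - ‖x‖ ^ 2) 0

theorem cutoff_nonneg (ρ : ℝ) (x : E3) : 0 ≤ cutoff ρ x := le_max_right _ _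

theorem cutoff_le {ρ : ℝ} (x : E3) : cutoff ρ x ≤ ρ ^ 2 :=
  max_le (by nlinarith [sq_nonneg ‖x‖]) (sq_nonneg ρ)

theorem cutoff_eq_zero {ρ : ℝ} (hρ : 0 < ρ) {x : E3} (hx : ρ ≤ ‖x‖) : cutoff ρ x = 0 :=
  max_eq_right (by nlinarith)

theorem continuous_cutoff (ρ : ℝ) : Continuous (cutoff ρ) := by
  unfold cutoff
  fun_prop

theorem hasPd_cutoff_pow (ρ : ℝ) (n : ℕ) (i : Fin 3) (x : E3) :
    HasPd (fun y => cutoff ρ y ^ (n + 2)) ((n + 2) * cutoff ρ x ^ (n + 1) * (0 - 2 * x i)) i x :=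
  HasPd.comp (f := fun y : E3 => ρ ^ 2 - ‖y‖ ^ 2) (c := fun s => max s 0 ^ (n + 2))
    (hasDerivAt_max_zero_pow n _) ((HasPd.const _).sub HasPd.norm_sq)

theorem contDiff_max_zero_pow (n : ℕ) : ContDiff ℝ 1 (fun s : ℝ => max s 0 ^ (n + 2)) := by
  rw [contDiff_one_iff_deriv]
  refine ⟨fun s => (hasDerivAt_max_zero_pow n s).differentiableAt, ?_⟩
  rw [funext fun s => (hasDerivAt_max_zero_pow n s).deriv]
  fun_prop

theorem contDiff_cutoff_pow (ρ : ℝ) (n : ℕ) : ContDiff ℝ 1 (fun y => cutoff ρ y ^ (n + 2)) :=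
  (contDiff_max_zero_pow n).comp
    (contDiff_const.sub (contDiff_norm_sq ℝ) : ContDiff ℝ 1 fun y : E3 => ρ ^ 2 - ‖y‖ ^ 2)

theorem contDiff_pd {g : E3 → ℝ} {n m : WithTop ℕ∞} (hg : ContDiff ℝ n g) (h : m + 1 ≤ n)
    (i : Fin 3) : ContDiff ℝ m (pd g i) :=
  (hg.fderiv_right h).clm_apply contDiff_const

namespace Truncation

variable {k δ : ℝ} {F F1 F2 : ℝ → ℝ}

theorem contDiff1 (hT : Truncation k δ F F1 F2) : ContDiff ℝ 1 F1 := by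
  rw [contDiff_one_iff_deriv]
  refine ⟨fun s => (hT.deriv1 s).differentiableAt, ?_⟩
  rw [funext fun s => (hT.deriv1 s).deriv]
  exact hT.cont2

theorem contDiff (hT : Truncation k δ F F1 F2) : ContDiff ℝ 1 F := by
  rw [contDiff_one_iff_deriv]
  refine ⟨fun s => (hT.deriv s).differentiableAt, ?_⟩
  rw [funext fun s => (hT.deriv s).deriv]
  exact hT.contDiff1.continuous

end Truncation

/-- The components of the horizontal field `(x₁, x₂, 0) / r²`. -/
def radialField (i : Fin 3) (x : E3) : ℝ :=
  (![1, 1, 0] : Fin 3 → ℝ) i * x i / (x 0 ^ 2 + x 1 ^ 2)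

theorem sum_mul_radialField {x : E3} (hx : x 0 ^ 2 + x 1 ^ 2 ≠ 0) :
    ∑ i, x i * radialField i x = 1 := by
  simp only [Fin.sum_univ_three, radialField]
  simp
  field_simp

theorem contDiffAt_radialField {x : E3} (hx : x 0 ^ 2 + x 1 ^ 2 ≠ 0) (i : Fin 3) :
    ContDiffAt ℝ 1 (radialField i) x := by
  unfold radialField
  exact ContDiffAt.div (by fun_prop) (by fun_prop) hx

theorem sum_pd_radialField {x : E3} (hx : x 0 ^ 2 + x 1 ^ 2 ≠ 0) :
    ∑ i, pd (radialField i) i x = 0 := by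
  have hr : ∀ i, HasPd (fun y : E3 => y 0 ^ 2 + y 1 ^ 2) ((if 0 = i then 2 * x 0 else 0) +
      (if 1 = i then 2 * x 1 else 0)) i x := fun i => by
    have := ((HasPd.coord (i := i) (x := x) 0).mul (HasPd.coord 0)).add
      ((HasPd.coord 1).mul (HasPd.coord 1))
    simp only [pow_two]
    refine ⟨this.1, this.2.trans ?_⟩
    split_ifs <;> ring
  have h : ∀ i, pd (radialField i) i x = _ := fun i =>
    (((HasPd.const ((![1, 1, 0] : Fin 3 → ℝ) i)).mul (HasPd.coord i)).mul
      (HasPd.comp (hasDerivAt_inv hx) (hr i))).2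
  simp only [h, Fin.sum_univ_three]
  simp
  field_simp
  ring

section Energy

variable {k δ : ℝ} {F F1 F2 : ℝ → ℝ} {g : E3 → ℝ} {b : Fin 3 → E3 → ℝ}

/-- The flux whose divergence appears in the local energy identity. -/
def energyFlux (F F1 : ℝ → ℝ) (g : E3 → ℝ) (b : Fin 3 → E3 → ℝ) (ρ : ℝ) (i : Fin 3) (x : E3) : ℝ :=
  F (g x) * F (g x) * cutoff ρ x ^ (2 + 2) * b i x -
    cutoff ρ x ^ (2 + 2) * (2 * (F (g x) * F1 (g x))) * pd g i x +
    F (g x) * F (g x) * (-8 * (x i * cutoff ρ x ^ (1 + 2))) +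
    2 * (F (g x) * F (g x) * cutoff ρ x ^ (2 + 2)) * radialField i x

theorem eventually_comp_eq_zero (hT : Truncation k δ F F1 F2) (hk : 0 < k) (hg : ContDiff ℝ 2 g)
    {x : E3} (hx : g x = 0) : ∀ᶠ y in nhds x, F (g y) = 0 := by
  have : ∀ᶠ y in nhds x, g y < k :=
    hg.continuous.continuousAt.eventually (eventually_lt_nhds (by rwa [hx]))
  filter_upwards [this] with y hy using hT.zero _ hy.le

theorem contDiff_energyFlux (hT : Truncation k δ F F1 F2) (hk : 0 < k) (hg : ContDiff ℝ 2 g)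
    (hb : ∀ i, ContDiff ℝ 1 (b i)) (hg0 : ∀ x, x 0 ^ 2 + x 1 ^ 2 = 0 → g x = 0) (ρ : ℝ)
    (i : Fin 3) : ContDiff ℝ 1 (energyFlux F F1 g b ρ i) := by
  rw [contDiff_iff_contDiffAt]
  intro x
  by_cases hx : x 0 ^ 2 + x 1 ^ 2 = 0
  · refine (contDiffAt_const (c := (0 : ℝ))).congr_of_eventuallyEq ?_
    filter_upwards [eventually_comp_eq_zero hT hk hg (hg0 x hx)] with y hy
    simp [energyFlux, hy]
  · have h1 : ContDiffAt ℝ 1 (fun x => F (g x)) x :=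
      (hT.contDiff.comp (hg.of_le (by norm_num))).contDiffAt
    have h2 : ContDiffAt ℝ 1 (fun x => F1 (g x)) x :=
      (hT.contDiff1.comp (hg.of_le (by norm_num))).contDiffAt
    have h3 := (contDiff_cutoff_pow ρ 2).contDiffAt (x := x)
    have h4 := (contDiff_cutoff_pow ρ 1).contDiffAt (x := x)
    have h5 := (contDiff_pd hg (m := 1) (by norm_num) i).contDiffAt (x := x)
    have h6 := (hb i).contDiffAt (x := x)
    have h7 := contDiffAt_radialField hx i
    have h8 : ContDiffAt ℝ 1 (fun x : E3 => x i) x := by fun_prop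
    unfold energyFlux
    exact ((((h1.mul h1).mul h3).mul h6).sub ((h3.mul (contDiffAt_const.mul (h1.mul h2))).mul h5)
      |>.add ((h1.mul h1).mul (contDiffAt_const.mul (h8.mul h4)))).add
      ((contDiffAt_const.mul ((h1.mul h1).mul h3)).mul h7)

theorem sum_pd_energyFlux (hT : Truncation k δ F F1 F2) (hk : 0 < k) (hg : ContDiff ℝ 2 g)
    (hb : ∀ i, ContDiff ℝ 1 (b i)) (hg0 : ∀ x, x 0 ^ 2 + x 1 ^ 2 = 0 → g x = 0) {ρ : ℝ}
    (hρ : 0 < ρ) {gt : E3 → ℝ}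
    (hpde : ∀ x, ‖x‖ < ρ → x 0 ^ 2 + x 1 ^ 2 ≠ 0 → (x 0 ^ 2 + x 1 ^ 2) *
      (gt x + ∑ i, b i x * pd g i x - lap g x) + 2 * (x 0 * pd g 0 x + x 1 * pd g 1 x) = 0)
    (hdiv : ∀ x, ‖x‖ < ρ → ∑ i, pd (b i) i x = 0) (x : E3) :
    ∑ i, pd (energyFlux F F1 g b ρ i) i x =
      -(cutoff ρ x ^ 4 * (2 * F (g x) * F1 (g x)) * gt x) -
      cutoff ρ x ^ 4 * (2 * F1 (g x) ^ 2 + 2 * F (g x) * F2 (g x)) * ∑ i, pd g i x ^ 2 +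
      F (g x) ^ 2 * (48 * ‖x‖ ^ 2 * cutoff ρ x ^ 2 - 8 * (∑ i, b i x * x i) * cutoff ρ x ^ 3 -
        40 * cutoff ρ x ^ 3) := by
  by_cases hx : x 0 ^ 2 + x 1 ^ 2 = 0
  · have h0 : ∀ i, pd (energyFlux F F1 g b ρ i) i x = 0 := fun i => by
      have : energyFlux F F1 g b ρ i =ᶠ[nhds x] fun _ => 0 := by
        filter_upwards [eventually_comp_eq_zero hT hk hg (hg0 x hx)] with y hy
        simp [energyFlux, hy]
      rw [pd, this.fderiv_eq]
      simp
    have hz : g x ≤ k := by rw [hg0 x hx]; exact hk.le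
    simp [h0, hT.zero _ hz, hT.zero1 _ hz]
  have d1 : ∀ i, HasPd (fun y => F (g y)) (F1 (g x) * pd g i x) i x := fun i =>
    HasPd.comp (hT.deriv _) (.of_differentiableAt (hg.differentiable (by norm_num) x))
  have d2 : ∀ i, HasPd (fun y => F1 (g y)) (F2 (g x) * pd g i x) i x := fun i =>
    HasPd.comp (hT.deriv1 _) (.of_differentiableAt (hg.differentiable (by norm_num) x))
  have d5 : ∀ i, HasPd (pd g i) (pd (pd g i) i x) i x := fun i =>
    .of_differentiableAt ((contDiff_pd hg (m := 1) (by norm_num) i).differentiable (by norm_num) x)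
  have d6 : ∀ i, HasPd (b i) (pd (b i) i x) i x := fun i =>
    .of_differentiableAt ((hb i).differentiable (by norm_num) x)
  have d7 : ∀ i, HasPd (radialField i) (pd (radialField i) i x) i x := fun i =>
    .of_differentiableAt ((contDiffAt_radialField hx i).differentiableAt (by norm_num))
  have h : ∀ i, pd (energyFlux F F1 g b ρ i) i x = _ := fun i =>
    (((((((d1 i).mul (d1 i)).mul (hasPd_cutoff_pow ρ 2 i x)).mul (d6 i)).sub
      (((hasPd_cutoff_pow ρ 2 i x).mul ((HasPd.const 2).mul ((d1 i).mul (d2 i)))).mul (d5 i))).add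
      (((d1 i).mul (d1 i)).mul
        ((HasPd.const (-8)).mul ((HasPd.coord i).mul (hasPd_cutoff_pow ρ 1 i x))))).add
      (((HasPd.const 2).mul (((d1 i).mul (d1 i)).mul (hasPd_cutoff_pow ρ 2 i x))).mul (d7 i))).2
  have hxV := sum_mul_radialField hx
  have hdV := sum_pd_radialField hx
  have hn : ‖x‖ ^ 2 = x 0 ^ 2 + x 1 ^ 2 + x 2 ^ 2 := by
    rw [EuclideanSpace.norm_sq_eq, Fin.sum_univ_three]
    simp
  rw [hn]
  simp only [h]
  rcases le_or_gt ρ ‖x‖ with hr | hr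
  · simp [cutoff_eq_zero hρ hr]
  have hp : gt x + ∑ i, b i x * pd g i x - lap g x + 2 * ∑ i, radialField i x * pd g i x = 0 := by
    have := hpde x hr hx
    have e : ∑ i, radialField i x * pd g i x =
        (x 0 * pd g 0 x + x 1 * pd g 1 x) / (x 0 ^ 2 + x 1 ^ 2) := by
      simp only [Fin.sum_univ_three, radialField]
      simp
      ring
    rw [e]
    field_simp
    linear_combination this
  have hd := hdiv x hr
  have hl : lap g x = ∑ i, pd (pd g i) i x := rfl
  rw [hl] at hp
  simp only [Fin.sum_univ_three] at *
  simp only [↓reduceIte, Nat.cast_ofNat, Nat.cast_one]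
  linear_combination (cutoff ρ x ^ 4 * (2 * F (g x) * F1 (g x))) * hp +
    F (g x) ^ 2 * cutoff ρ x ^ 4 * hd + 2 * F (g x) ^ 2 * cutoff ρ x ^ 4 * hdV -
    16 * F (g x) ^ 2 * cutoff ρ x ^ 3 * hxV

end Energy

section Slice

variable {k δ : ℝ} {F F1 F2 : ℝ → ℝ} {g : E3 → ℝ} {b : Fin 3 → E3 → ℝ}

/-- `C` is admissible in the Sobolev inequality `‖g‖₆⁶ ≤ C ‖∇g‖₂⁶`. -/
def SobolevConst (C : ℝ) : Prop :=
  0 < C ∧ ∀ (g : E3 → ℝ) (R : ℝ), ContDiff ℝ 1 g →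
    (∀ x, R < ‖x‖ → g x = 0) → ∫ x, g x ^ 6 ≤ C * (∫ x, ∑ i, pd g i x ^ 2) ^ 3

theorem integrable_mul_cutoff_pow {f : E3 → ℝ} (hf : Continuous f) {ρ : ℝ} (hρ : 0 < ρ) (n : ℕ) :
    Integrable fun x => f x * cutoff ρ x ^ (n + 1) :=
  integrable_of_eq_zero_off_closedBall (R := ρ) (hf.mul ((continuous_cutoff ρ).pow _)) fun x hx => by
    simp [cutoff_eq_zero hρ hx.le]

theorem energy_inequality_slice (hT : Truncation k δ F F1 F2) (hk : 0 < k) (hg : ContDiff ℝ 2 g)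
    (hb : ∀ i, ContDiff ℝ 1 (b i)) (hg0 : ∀ x, x 0 ^ 2 + x 1 ^ 2 = 0 → g x = 0) {ρ : ℝ}
    (hρ : 0 < ρ) {gt : E3 → ℝ} (hgt : Continuous gt)
    (hpde : ∀ x, ‖x‖ < ρ → x 0 ^ 2 + x 1 ^ 2 ≠ 0 → (x 0 ^ 2 + x 1 ^ 2) *
      (gt x + ∑ i, b i x * pd g i x - lap g x) + 2 * (x 0 * pd g 0 x + x 1 * pd g 1 x) = 0)
    (hdiv : ∀ x, ‖x‖ < ρ → ∑ i, pd (b i) i x = 0) :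
    (∫ x, 2 * F (g x) * F1 (g x) * gt x * cutoff ρ x ^ 4) +
      (∫ x, F1 (g x) ^ 2 * (∑ i, pd g i x ^ 2) * cutoff ρ x ^ 4) ≤
      (∫ x, F (g x) ^ 2 * (48 * ‖x‖ ^ 2) * cutoff ρ x ^ 2) +
      ∫ x, F (g x) ^ 2 * (8 * |∑ i, b i x * x i|) * cutoff ρ x ^ 3 := by
  have cF : Continuous F := hT.contDiff.continuous
  have cF1 : Continuous F1 := hT.contDiff1.continuous
  have cp : ∀ i, Continuous (pd g i) := continuous_pd (hg.of_le (by norm_num))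
  have cb : ∀ i, Continuous (b i) := fun i => (hb i).continuous
  have cg := hg.continuous
  have cS : Continuous fun x => ∑ i, pd g i x ^ 2 := by fun_prop
  have cB : Continuous fun x : E3 => ∑ i, b i x * x i := by fun_prop
  have i1 : Integrable fun x => 2 * F (g x) * F1 (g x) * gt x * cutoff ρ x ^ 4 :=
    integrable_mul_cutoff_pow (by fun_prop) hρ 3
  have i2 : Integrable fun x => F1 (g x) ^ 2 * (∑ i, pd g i x ^ 2) * cutoff ρ x ^ 4 :=
    integrable_mul_cutoff_pow (by fun_prop) hρ 3
  have i3 : Integrable fun x => F (g x) ^ 2 * (48 * ‖x‖ ^ 2) * cutoff ρ x ^ 2 :=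
    integrable_mul_cutoff_pow (by fun_prop) hρ 1
  have i4 : Integrable fun x => F (g x) ^ 2 * (8 * |∑ i, b i x * x i|) * cutoff ρ x ^ 3 :=
    integrable_mul_cutoff_pow (by fun_prop) hρ 2
  have hz : ∀ i x, ρ < ‖x‖ → energyFlux F F1 g b ρ i x = 0 := fun i x hx => by
    simp [energyFlux, cutoff_eq_zero hρ hx.le]
  have cE := fun i => contDiff_energyFlux hT hk hg hb hg0 ρ i
  have i5 : ∀ i, Integrable (pd (energyFlux F F1 g b ρ i) i) := fun i =>
    integrable_of_eq_zero_off_closedBall (continuous_pd (cE i) i)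
      (pd_eq_zero_off_closedBall (hz i) i)
  have i6 : Integrable fun x => ∑ i, pd (energyFlux F F1 g b ρ i) i x :=
    integrable_finsetSum _ fun i _ => i5 i
  have h0 : ∫ x, ∑ i, pd (energyFlux F F1 g b ρ i) i x = 0 := by
    rw [integral_finsetSum _ fun i _ => i5 i]
    exact Finset.sum_eq_zero fun i _ => integral_pd_eq_zero (cE i) (hz i) i
  have hm : (∫ x, (2 * F (g x) * F1 (g x) * gt x * cutoff ρ x ^ 4 +
      F1 (g x) ^ 2 * (∑ i, pd g i x ^ 2) * cutoff ρ x ^ 4) +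
      ∑ i, pd (energyFlux F F1 g b ρ i) i x) ≤
      ∫ x, (F (g x) ^ 2 * (48 * ‖x‖ ^ 2) * cutoff ρ x ^ 2 +
        F (g x) ^ 2 * (8 * |∑ i, b i x * x i|) * cutoff ρ x ^ 3) := by
    refine integral_mono ((i1.add i2).add i6) (i3.add i4) fun x => ?_
    simp only
    rw [sum_pd_energyFlux hT hk hg hb hg0 hρ hpde hdiv x]
    have q0 := cutoff_nonneg ρ x
    have s0 : 0 ≤ ∑ i, pd g i x ^ 2 := Finset.sum_nonneg fun i _ => sq_nonneg _
    have a1 : 0 ≤ (F1 (g x) ^ 2 + 2 * F (g x) * F2 (g x)) * (∑ i, pd g i x ^ 2) *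
        cutoff ρ x ^ 4 := mul_nonneg (mul_nonneg (hT.convex_sq _) s0) (by positivity)
    have a2 : 0 ≤ (|∑ i, b i x * x i| + ∑ i, b i x * x i) * (F (g x) ^ 2 * cutoff ρ x ^ 3) :=
      mul_nonneg (by linarith [neg_abs_le (∑ i, b i x * x i)]) (by positivity)
    have a3 : 0 ≤ F (g x) ^ 2 * cutoff ρ x ^ 3 := by positivity
    nlinarith
  have e1 := integral_add (i1.add i2) i6
  have e2 := integral_add i1 i2
  have e3 := integral_add i3 i4
  simp only [Pi.add_apply] at e1
  linarith

theorem integral_le_of_le_of_eq_zero {f h : E3 → ℝ} {ρ : ℝ} (hf : Continuous f) (hh : Continuous h)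
    (hz : ∀ x, ρ < ‖x‖ → f x = 0) (hle : ∀ x, ‖x‖ ≤ ρ → f x ≤ h x) :
    ∫ x, f x ≤ ∫ x in Metric.closedBall 0 ρ, h x := by
  rw [integral_eq_setIntegral_closedBall hz]
  refine setIntegral_mono_on (hf.continuousOn.integrableOn_compact (isCompact_closedBall _ _))
    (hh.continuousOn.integrableOn_compact (isCompact_closedBall _ _)) measurableSet_closedBall
    fun x hx => hle x (by simpa using hx)

theorem hasPd_truncation_mul_cutoff_sq (hT : Truncation k δ F F1 F2) (hg : ContDiff ℝ 2 g) (ρ : ℝ)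
    (i : Fin 3) (x : E3) : HasPd (fun y => F (g y) * cutoff ρ y ^ 2)
      (F1 (g x) * pd g i x * cutoff ρ x ^ 2 - 4 * F (g x) * cutoff ρ x * x i) i x := by
  have h := (HasPd.comp (hT.deriv (g x))
    (.of_differentiableAt (i := i) (hg.differentiable (by norm_num) x))).mul
    (hasPd_cutoff_pow ρ 0 i x)
  refine ⟨h.1, h.2.trans ?_⟩
  simp
  ring

theorem contDiff_truncation_mul_cutoff_sq (hT : Truncation k δ F F1 F2) (hg : ContDiff ℝ 2 g)
    (ρ : ℝ) : ContDiff ℝ 1 fun y => F (g y) * cutoff ρ y ^ 2 :=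
  (hT.contDiff.comp (hg.of_le (by norm_num))).mul (contDiff_cutoff_pow ρ 0)

theorem truncation_sq_le (hT : Truncation k δ F F1 F2) (s : ℝ) : F s ^ 2 ≤ max (s - k) 0 ^ 2 :=
  pow_le_pow_left₀ (hT.nonneg s) (hT.le_trunc s) 2

theorem gradient_sq_le (hT : Truncation k δ F F1 F2) (hg : ContDiff ℝ 2 g) {ρ R : ℝ}
    (hρ : 0 < ρ) (hρR : ρ ≤ R) :
    ∫ x, ∑ i, pd (fun y => F (g y) * cutoff ρ y ^ 2) i x ^ 2 ≤
      2 * (∫ x, F1 (g x) ^ 2 * (∑ i, pd g i x ^ 2) * cutoff ρ x ^ 4) +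
      32 * R ^ 6 * ∫ x in Metric.closedBall 0 ρ, max (g x - k) 0 ^ 2 := by
  have cF : Continuous F := hT.contDiff.continuous
  have cF1 : Continuous F1 := hT.contDiff1.continuous
  have cp : ∀ i, Continuous (pd g i) := continuous_pd (hg.of_le (by norm_num))
  have cS : Continuous fun x => ∑ i, pd g i x ^ 2 := by fun_prop
  have cq := continuous_cutoff ρ
  have cg := hg.continuous
  have i2 : Integrable fun x => 2 * (F1 (g x) ^ 2 * (∑ i, pd g i x ^ 2) * cutoff ρ x ^ 4) :=
    (integrable_mul_cutoff_pow (by fun_prop) hρ 3).const_mul 2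
  have i3 : Integrable fun x => 32 * F (g x) ^ 2 * ‖x‖ ^ 2 * cutoff ρ x ^ 2 :=
    integrable_mul_cutoff_pow (by fun_prop) hρ 1
  calc _ ≤ ∫ x, (2 * (F1 (g x) ^ 2 * (∑ i, pd g i x ^ 2) * cutoff ρ x ^ 4) +
        32 * F (g x) ^ 2 * ‖x‖ ^ 2 * cutoff ρ x ^ 2) := by
        refine integral_mono_of_nonneg (.of_forall fun x => Finset.sum_nonneg fun i _ => sq_nonneg _)
          (i2.add i3) (.of_forall fun x => ?_)
        simp only
        have hn : ‖x‖ ^ 2 = ∑ i, x i ^ 2 := by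
          rw [EuclideanSpace.norm_sq_eq]
          simp
        rw [hn, Finset.sum_congr rfl fun i _ =>
          congrArg (· ^ 2) (hasPd_truncation_mul_cutoff_sq hT hg ρ i x).2]
        have : ∀ i, (F1 (g x) * pd g i x * cutoff ρ x ^ 2 - 4 * F (g x) * cutoff ρ x * x i) ^ 2 ≤
            2 * (F1 (g x) ^ 2 * (pd g i x ^ 2) * cutoff ρ x ^ 4) +
              32 * F (g x) ^ 2 * (x i ^ 2) * cutoff ρ x ^ 2 := fun i => by
          nlinarith [sq_nonneg (F1 (g x) * pd g i x * cutoff ρ x ^ 2 +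
            4 * F (g x) * cutoff ρ x * x i)]
        refine (Finset.sum_le_sum fun i _ => this i).trans_eq ?_
        simp only [Fin.sum_univ_three]
        ring
    _ = 2 * (∫ x, F1 (g x) ^ 2 * (∑ i, pd g i x ^ 2) * cutoff ρ x ^ 4) +
        ∫ x, 32 * F (g x) ^ 2 * ‖x‖ ^ 2 * cutoff ρ x ^ 2 := by
        rw [integral_add i2 i3, integral_const_mul]
    _ ≤ _ := by
        rw [← integral_const_mul (32 * R ^ 6)]
        gcongr
        refine integral_le_of_le_of_eq_zero (by fun_prop) (by fun_prop)
          (fun x hx => by simp [cutoff_eq_zero hρ hx.le]) fun x hx => ?_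
        have h1 := cutoff_le (ρ := ρ) x
        have h0 := cutoff_nonneg ρ x
        calc 32 * F (g x) ^ 2 * ‖x‖ ^ 2 * cutoff ρ x ^ 2
            ≤ 32 * max (g x - k) 0 ^ 2 * R ^ 2 * (R ^ 2) ^ 2 := by
              have := truncation_sq_le hT (g x)
              have hx' := hx.trans hρR
              have h2 : cutoff ρ x ≤ R ^ 2 := h1.trans (by gcongr)
              gcongr
          _ = _ := by ring

theorem drift_pow_four_le {C : ℝ} (hC : SobolevConst C) (hT : Truncation k δ F F1 F2)
    (hg : ContDiff ℝ 2 g) {ρ R A : ℝ} (hρ : 0 < ρ) (hρR : ρ ≤ R) {β : E3 → ℝ} (hβ : Continuous β)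
    (hA : ∫ x in Metric.closedBall 0 R, β x ^ 2 ≤ A * R) :
    (∫ x, β x * F (g x) ^ 2 * cutoff ρ x ^ 3) ^ 4 ≤
      (A * R) ^ 2 * ((∫ x in Metric.closedBall 0 ρ, max (g x - k) 0 ^ 2) *
        (C * (∫ x, ∑ i, pd (fun y => F (g y) * cutoff ρ y ^ 2) i x ^ 2) ^ 3)) := by
  have cF : Continuous F := hT.contDiff.continuous
  have cq := continuous_cutoff ρ
  have cg := hg.continuous
  have int : ∀ {r : ℝ} {f : E3 → ℝ}, Continuous f → IntegrableOn f (Metric.closedBall 0 r) :=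
    fun hf => hf.continuousOn.integrableOn_compact (isCompact_closedBall _ _)
  have z : ∀ x : E3, ρ < ‖x‖ → cutoff ρ x = 0 := fun x hx => cutoff_eq_zero hρ hx.le
  have s1 : (∫ x, β x * F (g x) ^ 2 * cutoff ρ x ^ 3) ^ 2 ≤
      (∫ x in Metric.closedBall 0 ρ, β x ^ 2) *
        ∫ x in Metric.closedBall 0 ρ, (F (g x) ^ 2 * cutoff ρ x ^ 3) ^ 2 := by
    rw [integral_eq_setIntegral_closedBall (R := ρ) (fun x hx => by simp [z x hx])]
    simp only [mul_assoc]
    exact sq_integral_mul_le (int (by fun_prop)) (int (by fun_prop)) (int (by fun_prop))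
  have s2 : (∫ x in Metric.closedBall 0 ρ, (F (g x) ^ 2 * cutoff ρ x ^ 3) ^ 2) ^ 2 ≤
      (∫ x in Metric.closedBall 0 ρ, F (g x) ^ 2) *
        ∫ x in Metric.closedBall 0 ρ, (F (g x) ^ 3 * cutoff ρ x ^ 6) ^ 2 := by
    have : ∀ x, (F (g x) ^ 2 * cutoff ρ x ^ 3) ^ 2 = F (g x) * (F (g x) ^ 3 * cutoff ρ x ^ 6) :=
      fun x => by ring
    simp only [this]
    exact sq_integral_mul_le (int (by fun_prop)) (int (by fun_prop)) (int (by fun_prop))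
  have s3 : ∫ x in Metric.closedBall 0 ρ, (F (g x) ^ 3 * cutoff ρ x ^ 6) ^ 2 ≤
      C * (∫ x, ∑ i, pd (fun y => F (g y) * cutoff ρ y ^ 2) i x ^ 2) ^ 3 := by
    refine le_trans (le_of_eq ?_) (hC.2 _ ρ (contDiff_truncation_mul_cutoff_sq hT hg ρ)
      fun x hx => by simp [z x hx])
    rw [integral_eq_setIntegral_closedBall (R := ρ) (fun x hx => by simp [z x hx])]
    congr 1
    ext x
    ring
  have s4 : ∫ x in Metric.closedBall 0 ρ, F (g x) ^ 2 ≤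
      ∫ x in Metric.closedBall 0 ρ, max (g x - k) 0 ^ 2 :=
    setIntegral_mono (int (by fun_prop)) (int (by fun_prop)) fun x => truncation_sq_le hT _
  have s5 : ∫ x in Metric.closedBall 0 ρ, β x ^ 2 ≤ A * R :=
    (setIntegral_mono_set (int (by fun_prop)) (.of_forall fun x => sq_nonneg _)
      (Metric.closedBall_subset_closedBall hρR).eventuallyLE).trans hA
  have n1 : 0 ≤ ∫ x in Metric.closedBall 0 ρ, β x ^ 2 := integral_nonneg fun x => sq_nonneg _
  have n2 : 0 ≤ ∫ x in Metric.closedBall 0 ρ, F (g x) ^ 2 := integral_nonneg fun x => sq_nonneg _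
  have n3 : 0 ≤ ∫ x in Metric.closedBall 0 ρ, (F (g x) ^ 3 * cutoff ρ x ^ 6) ^ 2 :=
    integral_nonneg fun x => sq_nonneg _
  calc _ = ((∫ x, β x * F (g x) ^ 2 * cutoff ρ x ^ 3) ^ 2) ^ 2 := by ring
    _ ≤ ((∫ x in Metric.closedBall 0 ρ, β x ^ 2) *
        ∫ x in Metric.closedBall 0 ρ, (F (g x) ^ 2 * cutoff ρ x ^ 3) ^ 2) ^ 2 := by gcongr
    _ = (∫ x in Metric.closedBall 0 ρ, β x ^ 2) ^ 2 *
        (∫ x in Metric.closedBall 0 ρ, (F (g x) ^ 2 * cutoff ρ x ^ 3) ^ 2) ^ 2 := by ring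
    _ ≤ (A * R) ^ 2 * ((∫ x in Metric.closedBall 0 ρ, F (g x) ^ 2) *
        ∫ x in Metric.closedBall 0 ρ, (F (g x) ^ 3 * cutoff ρ x ^ 6) ^ 2) := by gcongr
    _ ≤ _ := by gcongr

theorem slice_estimate {C : ℝ} (hC : SobolevConst C) (hT : Truncation k δ F F1 F2) (hk : 0 < k)
    (hg : ContDiff ℝ 2 g)
    (hb : ∀ i, ContDiff ℝ 1 (b i)) (hg0 : ∀ x, x 0 ^ 2 + x 1 ^ 2 = 0 → g x = 0) {ρ R A : ℝ}
    (hρ : 0 < ρ) (hρR : ρ ≤ R) (hA0 : 0 ≤ A) {gt : E3 → ℝ} (hgt : Continuous gt)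
    (hpde : ∀ x, ‖x‖ < ρ → x 0 ^ 2 + x 1 ^ 2 ≠ 0 → (x 0 ^ 2 + x 1 ^ 2) *
      (gt x + ∑ i, b i x * pd g i x - lap g x) + 2 * (x 0 * pd g 0 x + x 1 * pd g 1 x) = 0)
    (hdiv : ∀ x, ‖x‖ < ρ → ∑ i, pd (b i) i x = 0)
    {β : E3 → ℝ} (hβ : Continuous β) (hβb : ∀ x, |∑ i, b i x * x i| ≤ β x * ‖x‖)
    (hA : ∫ x in Metric.closedBall 0 R, β x ^ 2 ≤ A * R) :
    (∫ x, 2 * F (g x) * F1 (g x) * gt x * cutoff ρ x ^ 4) +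
      (∫ x, ∑ i, pd (fun y => F (g y) * cutoff ρ y ^ 2) i x ^ 2) / 4 ≤
      (64 + 65536 * C) * (1 + A) ^ 2 * R ^ 6 *
        ∫ x in Metric.closedBall 0 ρ, max (g x - k) 0 ^ 2 := by
  have cF : Continuous F := hT.contDiff.continuous
  have cq := continuous_cutoff ρ
  have cg := hg.continuous
  have cb : ∀ i, Continuous (b i) := fun i => (hb i).continuous
  have cB : Continuous fun x : E3 => ∑ i, b i x * x i := by fun_prop
  have z : ∀ x : E3, ρ < ‖x‖ → cutoff ρ x = 0 := fun x hx => cutoff_eq_zero hρ hx.le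
  have hR : 0 < R := hρ.trans_le hρR
  have h1 := energy_inequality_slice hT hk hg hb hg0 hρ hgt hpde hdiv
  have h2 := gradient_sq_le hT hg hρ hρR (F1 := F1)
  have h3 := drift_pow_four_le hC hT hg hρ hρR hβ hA
  set N := ∫ x in Metric.closedBall 0 ρ, max (g x - k) 0 ^ 2 with hN
  set J := ∫ x, ∑ i, pd (fun y => F (g y) * cutoff ρ y ^ 2) i x ^ 2
  have hN0 : 0 ≤ N := integral_nonneg fun x => sq_nonneg _
  have hJ0 : 0 ≤ J := integral_nonneg fun x => Finset.sum_nonneg fun i _ => sq_nonneg _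
  have h4 : ∫ x, F (g x) ^ 2 * (48 * ‖x‖ ^ 2) * cutoff ρ x ^ 2 ≤ 48 * R ^ 6 * N := by
    rw [hN, ← integral_const_mul]
    refine integral_le_of_le_of_eq_zero (by fun_prop) (by fun_prop)
      (fun x hx => by simp [z x hx]) fun x hx => ?_
    have k1 := cutoff_le (ρ := ρ) x
    have k0 := cutoff_nonneg ρ x
    calc F (g x) ^ 2 * (48 * ‖x‖ ^ 2) * cutoff ρ x ^ 2
        ≤ max (g x - k) 0 ^ 2 * (48 * R ^ 2) * (R ^ 2) ^ 2 := by
          have := truncation_sq_le hT (g x)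
          have hx' := hx.trans hρR
          have k2 : cutoff ρ x ≤ R ^ 2 := k1.trans (by gcongr)
          gcongr
      _ = _ := by ring
  have h5 : ∫ x, F (g x) ^ 2 * (8 * |∑ i, b i x * x i|) * cutoff ρ x ^ 3 ≤
      8 * R * ∫ x, β x * F (g x) ^ 2 * cutoff ρ x ^ 3 := by
    rw [← integral_const_mul]
    refine integral_mono (integrable_mul_cutoff_pow (by fun_prop) hρ 2)
      ((integrable_mul_cutoff_pow (by fun_prop) hρ 2).const_mul _) fun x => ?_
    simp only
    rcases lt_or_ge ρ ‖x‖ with hx | hx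
    · simp [z x hx]
    have k0 := cutoff_nonneg ρ x
    have k1 : 0 ≤ F (g x) ^ 2 * cutoff ρ x ^ 3 := by positivity
    have k2 : |∑ i, b i x * x i| ≤ β x * R := by
      rcases eq_or_ne x 0 with rfl | hx0
      · have : 0 ≤ β 0 := by
          refine ge_of_tendsto (hβ.continuousWithinAt (s := {0}ᶜ)) ?_
          filter_upwards [self_mem_nhdsWithin] with y hy
          exact nonneg_of_mul_nonneg_left ((abs_nonneg _).trans (hβb y)) (norm_pos_iff.mpr hy)
        simpa using mul_nonneg this hR.le
      have : 0 ≤ β x :=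
        nonneg_of_mul_nonneg_left ((abs_nonneg _).trans (hβb x)) (norm_pos_iff.mpr hx0)
      exact (hβb x).trans (by gcongr; linarith)
    nlinarith
  have h6 : 8 * R * (∫ x, β x * F (g x) ^ 2 * cutoff ρ x ^ 3) ≤
      J / 4 + 65536 * C * A ^ 2 * R ^ 6 * N := by
    have := hC.1
    refine le_add_of_pow_four_le (by positivity) (by positivity) ?_
    rw [mul_pow]
    calc _ ≤ (8 * R) ^ 4 * ((A * R) ^ 2 * (N * (C * J ^ 3))) := by gcongr
      _ = _ := by ring
  have h7 : (64 + 65536 * C * A ^ 2) * (R ^ 6 * N) ≤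
      ((64 + 65536 * C) * (1 + A) ^ 2) * (R ^ 6 * N) := by
    refine mul_le_mul_of_nonneg_right ?_ (by positivity)
    nlinarith [hC.1, mul_nonneg hC.1.le hA0, mul_nonneg hA0 hA0]
  linarith

theorem integral_pow_three_pow_four_le {h : E3 → ℝ} (ch : Continuous h) {ρ : ℝ}
    (hz : ∀ x, ρ < ‖x‖ → h x = 0) :
    (∫ x, h x ^ 3) ^ 4 ≤ (∫ x, h x ^ 2) ^ 3 * ∫ x, h x ^ 6 := by
  have int : ∀ n : ℕ, n ≠ 0 → Integrable fun x => h x ^ n := fun n hn =>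
    integrable_of_eq_zero_off_closedBall (R := ρ) (ch.pow _) fun x hx => by simp [hz x hx, hn]
  have s1 : (∫ x, h x ^ 3) ^ 2 ≤ (∫ x, h x ^ 2) * ∫ x, h x ^ 4 := by
    have e3 : ∀ x, h x ^ 3 = h x * h x ^ 2 := fun x => by ring
    have e4 : ∀ x, h x ^ 4 = (h x ^ 2) ^ 2 := fun x => by ring
    have i3 := int 3 (by norm_num)
    have i4 := int 4 (by norm_num)
    simp only [e3, e4] at i3 i4 ⊢
    exact sq_integral_mul_le (int 2 (by norm_num)) i4 i3
  have s2 : (∫ x, h x ^ 4) ^ 2 ≤ (∫ x, h x ^ 2) * ∫ x, h x ^ 6 := by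
    have e4 : ∀ x, h x ^ 4 = h x * h x ^ 3 := fun x => by ring
    have e6 : ∀ x, h x ^ 6 = (h x ^ 3) ^ 2 := fun x => by ring
    have i4 := int 4 (by norm_num)
    have i6 := int 6 (by norm_num)
    simp only [e4, e6] at i4 i6 ⊢
    exact sq_integral_mul_le (int 2 (by norm_num)) i6 i4
  have n2 : 0 ≤ ∫ x, h x ^ 2 := integral_nonneg fun x => sq_nonneg _
  calc (∫ x, h x ^ 3) ^ 4 = ((∫ x, h x ^ 3) ^ 2) ^ 2 := by ring
    _ ≤ ((∫ x, h x ^ 2) * ∫ x, h x ^ 4) ^ 2 := by gcongr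
    _ = (∫ x, h x ^ 2) ^ 2 * (∫ x, h x ^ 4) ^ 2 := by ring
    _ ≤ (∫ x, h x ^ 2) ^ 2 * ((∫ x, h x ^ 2) * ∫ x, h x ^ 6) := by gcongr
    _ = _ := by ring

theorem integral_cube_pow_four_le {C : ℝ} (hC : SobolevConst C) (hT : Truncation k δ F F1 F2)
    (hg : ContDiff ℝ 2 g) {ρ : ℝ} (hρ : 0 < ρ) :
    (∫ x, F (g x) ^ 3 * cutoff ρ x ^ 6) ^ 4 ≤
      C * (∫ x, F (g x) ^ 2 * cutoff ρ x ^ 4) ^ 3 *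
        (∫ x, ∑ i, pd (fun y => F (g y) * cutoff ρ y ^ 2) i x ^ 2) ^ 3 := by
  have hz : ∀ x, ρ < ‖x‖ → F (g x) * cutoff ρ x ^ 2 = 0 := fun x hx => by
    simp [cutoff_eq_zero hρ hx.le]
  have h := contDiff_truncation_mul_cutoff_sq hT hg ρ
  have e3 : ∀ x, F (g x) ^ 3 * cutoff ρ x ^ 6 = (F (g x) * cutoff ρ x ^ 2) ^ 3 := fun x => by ring
  have e2 : ∀ x, F (g x) ^ 2 * cutoff ρ x ^ 4 = (F (g x) * cutoff ρ x ^ 2) ^ 2 := fun x => by ring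
  simp only [e3, e2]
  have n2 : 0 ≤ ∫ x, (F (g x) * cutoff ρ x ^ 2) ^ 2 := integral_nonneg fun x => sq_nonneg _
  refine (integral_pow_three_pow_four_le h.continuous hz).trans ?_
  rw [mul_comm C, mul_assoc]
  exact mul_le_mul_of_nonneg_left (hC.2 _ ρ h hz) (pow_nonneg n2 3)

end Slice

theorem integral_le_of_energy_inequality {I I' J N Z : ℝ → ℝ} {T T' K L C m : ℝ} (hT' : 0 < T')
    (hT : T' < T) (hK : 0 ≤ K) (hL : 0 ≤ L) (hC : 0 ≤ C) (hm : 0 < m) (cI : Continuous I)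
    (cJ : Continuous J) (cN : Continuous N) (cZ : Continuous Z) (hI : ∀ t, HasDerivAt I (I' t) t)
    (hIJ : ∀ t ∈ Ioo (-T) 0, I' t + J t / 4 ≤ L * N t) (hIN : ∀ t, I t ≤ K * N t)
    (I0 : ∀ t, 0 ≤ I t) (J0 : ∀ t, 0 ≤ J t) (N0 : ∀ t, 0 ≤ N t)
    (hZ : ∀ t, Z t ^ 4 ≤ C * I t ^ 3 * J t ^ 3) :
    ∫ t in (-T')..0, Z t ≤ √((K / (T - T') + 2 * L) * ∫ t in (-T)..0, N t) *
      (4 * ((K / (T - T') + 2 * L) * ∫ t in (-T)..0, N t) / m +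
        C * m ^ 3 * (K * ∫ t in (-T)..0, N t)) := by
  set Y := ∫ t in (-T)..0, N t with hY
  have hd : 0 < T - T' := by linarith
  have iN : ∀ a b, IntervalIntegrable N volume a b := fun a b => cN.intervalIntegrable a b
  have iJ : ∀ a b, IntervalIntegrable J volume a b := fun a b => cJ.intervalIntegrable a b
  have Nmono : ∀ a b, -T ≤ a → a ≤ b → b ≤ 0 → ∫ t in a..b, N t ≤ Y := fun a b h1 h2 h3 =>
    intervalIntegral.integral_mono_interval h1 h2 h3 (.of_forall N0) (iN _ _)
  have Y0 : 0 ≤ Y := intervalIntegral.integral_nonneg (by linarith) fun t _ => N0 t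
  set B := (K / (T - T') + 2 * L) * Y with hB
  have B0 : 0 ≤ B := by positivity
  have h1 : I (-T') ≤ (K / (T - T') + L) * Y := by
    have := intervalIntegral.sub_le_integral_of_hasDeriv_right_of_le (a := -T) (b := -T')
      (g := fun t => (t + T) * I t) (g' := fun t => 1 * I t + (t + T) * I' t)
      (φ := fun t => (K + (T - T') * L) * N t) (by linarith) (by fun_prop)
      (fun t _ => (((hasDerivAt_id t).add_const T).mul (hI t)).hasDerivWithinAt)
      (((continuous_const.mul cN).continuousOn).integrableOn_compact isCompact_Icc)
      (fun t ht => by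
        have e1 := hIJ t ⟨ht.1, by linarith [ht.2]⟩
        have e2 := hIN t
        have e3 : (t + T) * I' t ≤ (t + T) * (L * N t) :=
          mul_le_mul_of_nonneg_left (by linarith [J0 t]) (by linarith [ht.1])
        have e4 : (t + T) * (L * N t) ≤ (T - T') * (L * N t) :=
          mul_le_mul_of_nonneg_right (by linarith [ht.2]) (mul_nonneg hL (N0 t))
        linarith)
    rw [intervalIntegral.integral_const_mul] at this
    have e5 := mul_le_mul_of_nonneg_left (Nmono (-T) (-T') le_rfl (by linarith) (by linarith))
      (by positivity : 0 ≤ K + (T - T') * L)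
    have e6 : (T - T') * I (-T') ≤ (T - T') * ((K / (T - T') + L) * Y) := by
      have e7 : (T - T') * ((K / (T - T') + L) * Y) = (K + (T - T') * L) * Y := by field_simp
      rw [e7]
      simp only [neg_add_cancel, zero_mul, sub_zero] at this
      linarith
    exact le_of_mul_le_mul_left e6 hd
  have h2 : ∀ t ∈ Icc (-T') 0, I t + (∫ s in (-T')..t, J s) / 4 ≤ B := fun t ht => by
    have := intervalIntegral.sub_le_integral_of_hasDeriv_right_of_le (a := -T') (b := t)
      (g := I) (g' := I') (φ := fun t => L * N t - J t / 4) ht.1 cI.continuousOn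
      (fun t _ => (hI t).hasDerivWithinAt)
      ((((continuous_const.mul cN).sub (cJ.div_const 4)).continuousOn).integrableOn_compact
        isCompact_Icc)
      (fun s hs => by linarith [hIJ s ⟨by linarith [hs.1], by linarith [hs.2, ht.2]⟩])
    rw [intervalIntegral.integral_sub ((iN _ _).const_mul _) ((iJ _ _).div_const _),
      intervalIntegral.integral_const_mul, intervalIntegral.integral_div] at this
    have e5 := mul_le_mul_of_nonneg_left (Nmono (-T') t (by linarith) ht.1 ht.2) hL
    linarith
  have hJB : ∫ t in (-T')..0, J t ≤ 4 * B := by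
    linarith [h2 0 ⟨by linarith, le_rfl⟩, I0 0]
  have h3 : ∀ t ∈ Icc (-T') 0, Z t ≤ √B * (J t / m + C * m ^ 3 * (K * N t)) := fun t ht => by
    have e1 : I t ≤ B := by
      have : 0 ≤ ∫ s in (-T')..t, J s := intervalIntegral.integral_nonneg ht.1 fun s _ => J0 s
      linarith [h2 t ht]
    have i0 := I0 t
    have j0 := J0 t
    have e2 : Z t ≤ √(I t) * (J t / m) + √(I t) * (C * m ^ 3 * I t) := by
      refine le_add_of_pow_four_le (by positivity) (by positivity) ((hZ t).trans ?_)
      have : √(I t) ^ 4 = I t ^ 2 := by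
        rw [show 4 = 2 * 2 by norm_num, pow_mul, Real.sq_sqrt i0]
      have e : 4 * (√(I t) * (J t / m)) ^ 3 * (√(I t) * (C * m ^ 3 * I t)) =
          4 * (C * I t * J t ^ 3 * √(I t) ^ 4) := by
        field_simp
      rw [e, this]
      have : 0 ≤ C * I t ^ 3 * J t ^ 3 := by positivity
      linarith
    calc Z t ≤ √(I t) * (J t / m + C * m ^ 3 * I t) := by linarith
      _ ≤ √B * (J t / m + C * m ^ 3 * (K * N t)) := by
        gcongr
        exact hIN t
  have i5 : IntervalIntegrable (fun t => C * m ^ 3 * (K * N t)) volume (-T') 0 :=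
    ((iN _ _).const_mul _).const_mul _
  calc ∫ t in (-T')..0, Z t ≤ ∫ t in (-T')..0, √B * (J t / m + C * m ^ 3 * (K * N t)) :=
        intervalIntegral.integral_mono_on (by linarith) (cZ.intervalIntegrable _ _)
          ((((iJ _ _).div_const m).add i5).const_mul _) h3
    _ = √B * ((∫ t in (-T')..0, J t) / m + C * m ^ 3 * (K * ∫ t in (-T')..0, N t)) := by
        rw [intervalIntegral.integral_const_mul, intervalIntegral.integral_add
          ((iJ _ _).div_const m) i5, intervalIntegral.integral_div,
          intervalIntegral.integral_const_mul, intervalIntegral.integral_const_mul]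
    _ ≤ _ := by
        have := Nmono (-T') 0 (by linarith) (by linarith) le_rfl
        gcongr

theorem continuous_setIntegral_closedBall {f : E3 → ℝ → ℝ}
    (hf : Continuous fun z : E3 × ℝ => f z.1 z.2) (ρ : ℝ) :
    Continuous fun t => ∫ x in Metric.closedBall 0 ρ, f x t :=
  continuous_parametric_integral_of_continuous (f := fun t x => f x t)
    (hf.comp continuous_swap) (isCompact_closedBall _ _)

theorem hasDerivAt_setIntegral_closedBall {f f' : E3 → ℝ → ℝ}
    (hf : Continuous fun z : E3 × ℝ => f z.1 z.2) (hf' : Continuous fun z : E3 × ℝ => f' z.1 z.2)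
    (hd : ∀ x t, HasDerivAt (f x) (f' x t) t) (ρ t : ℝ) :
    HasDerivAt (fun s => ∫ x in Metric.closedBall 0 ρ, f x s)
      (∫ x in Metric.closedBall 0 ρ, f' x t) t := by
  obtain ⟨M, hM⟩ := (((isCompact_closedBall (0 : E3) ρ).prod
    (isCompact_closedBall t 1)).bddAbove_image hf'.norm.continuousOn)
  have cs : ∀ s, Continuous fun x => f x s := fun s => hf.comp (by fun_prop : Continuous fun x => (x, s))
  have cs' : ∀ s, Continuous fun x => f' x s := fun s =>
    hf'.comp (by fun_prop : Continuous fun x => (x, s))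
  refine (hasDerivAt_integral_of_dominated_loc_of_deriv_le (bound := fun _ => M)
    (F := fun s x => f x s) (F' := fun s x => f' x s)
    (Metric.closedBall_mem_nhds t one_pos) (.of_forall fun s => (cs s).aestronglyMeasurable)
    ((cs t).continuousOn.integrableOn_compact (isCompact_closedBall _ _))
    (cs' t).aestronglyMeasurable ?_ ?_ (.of_forall fun x s _ => hd x s)).2
  · rw [ae_restrict_iff' measurableSet_closedBall]
    exact .of_forall fun x hx s hs => hM ⟨(x, s), ⟨hx, hs⟩, rfl⟩
  · exact integrableOn_const (isCompact_closedBall _ _).measure_lt_top.ne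

section Slicing

variable {g : E3 → ℝ → ℝ}

theorem contDiff_slice {E : Type*} [NormedAddCommGroup E] [NormedSpace ℝ E] {f : E3 → ℝ → E}
    {n : WithTop ℕ∞} (hf : ContDiff ℝ n fun z : E3 × ℝ => f z.1 z.2) (t : ℝ) :
    ContDiff ℝ n fun x => f x t :=
  hf.comp (contDiff_id.prodMk contDiff_const)

theorem pd_slice (hg : ContDiff ℝ 1 fun z : E3 × ℝ => g z.1 z.2) (i : Fin 3) (x : E3) (t : ℝ) :
    pd (fun y => g y t) i x = fderiv ℝ (fun z : E3 × ℝ => g z.1 z.2) (x, t) (ee i, 0) := by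
  have h1 : HasFDerivAt (fun z : E3 × ℝ => g z.1 z.2)
    (fderiv ℝ (fun z : E3 × ℝ => g z.1 z.2) (x, t)) (x, t) :=
    (hg.differentiable (by norm_num) (x, t)).hasFDerivAt
  have h2 : HasFDerivAt (fun y : E3 => (y, t))
      ((ContinuousLinearMap.id ℝ E3).prod (0 : E3 →L[ℝ] ℝ)) x :=
    (hasFDerivAt_id x).prodMk (hasFDerivAt_const t x)
  have h3 := h1.comp x h2
  rw [pd, show (fun y => g y t) = (fun z : E3 × ℝ => g z.1 z.2) ∘ fun y : E3 => (y, t) from rfl,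
    h3.fderiv]
  simp

theorem hasDerivAt_slice (hg : ContDiff ℝ 1 fun z : E3 × ℝ => g z.1 z.2) (x : E3) (t : ℝ) :
    HasDerivAt (g x) (fderiv ℝ (fun z : E3 × ℝ => g z.1 z.2) (x, t) (0, 1)) t := by
  have h1 : HasFDerivAt (fun z : E3 × ℝ => g z.1 z.2)
    (fderiv ℝ (fun z : E3 × ℝ => g z.1 z.2) (x, t)) (x, t) :=
    (hg.differentiable (by norm_num) (x, t)).hasFDerivAt
  have h2 : HasDerivAt (fun s : ℝ => (x, s)) ((0 : E3), (1 : ℝ)) t :=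
    (hasDerivAt_const t x).prodMk (hasDerivAt_id t)
  exact h1.comp_hasDerivAt t h2

theorem continuous_pd_slice (hg : ContDiff ℝ 1 fun z : E3 × ℝ => g z.1 z.2) (i : Fin 3) :
    Continuous fun z : E3 × ℝ => pd (fun y => g y z.2) i z.1 := by
  simp only [pd_slice hg]
  exact (hg.continuous_fderiv (by norm_num)).clm_apply continuous_const

theorem continuous_deriv_slice (hg : ContDiff ℝ 1 fun z : E3 × ℝ => g z.1 z.2) :
    Continuous fun z : E3 × ℝ => deriv (g z.1) z.2 := by
  simp only [(hasDerivAt_slice hg _ _).deriv]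
  exact (hg.continuous_fderiv (by norm_num)).clm_apply continuous_const

end Slicing

/-- A scalar `G` transported by a divergence-free field `u` on `Q(R)` and solving the equation of
the swirl `r uᶿ` of an axisymmetric flow, where `u` has scaled kinetic energy at most `A`. -/
structure IsSwirl (u : E3 → ℝ → E3) (G : E3 → ℝ → ℝ) (R A : ℝ) : Prop where
  smooth_u : ContDiff ℝ 1 fun z : E3 × ℝ => u z.1 z.2
  smooth_G : ContDiff ℝ 2 fun z : E3 × ℝ => G z.1 z.2
  axis : ∀ x t, x 0 ^ 2 + x 1 ^ 2 = 0 → G x t = 0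
  divfree : ∀ x, ∀ t ∈ Ioo (-R ^ 2) 0, ‖x‖ < R → ∑ i, pd (fun y => u y t i) i x = 0
  pde : ∀ x, ∀ t ∈ Ioo (-R ^ 2) 0, ‖x‖ < R → x 0 ^ 2 + x 1 ^ 2 ≠ 0 →
    (x 0 ^ 2 + x 1 ^ 2) * (deriv (G x) t + ∑ i, u x t i * pd (fun y => G y t) i x -
      lap (fun y => G y t) x) +
      2 * (x 0 * pd (fun y => G y t) 0 x + x 1 * pd (fun y => G y t) 1 x) = 0
  A_nonneg : 0 ≤ A
  energy : ∀ t ∈ Ioo (-R ^ 2) 0, ∫ x in Metric.closedBall 0 R, ‖u x t‖ ^ 2 ≤ A * R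

/-- `∫_{B(ρ)} (G - k)₊² dx` at time `t`. -/
def truncEnergy (G : E3 → ℝ → ℝ) (ρ k t : ℝ) : ℝ :=
  ∫ x in Metric.closedBall 0 ρ, max (G x t - k) 0 ^ 2

theorem continuous_truncEnergy {G : E3 → ℝ → ℝ} (hG : Continuous fun z : E3 × ℝ => G z.1 z.2)
    (ρ k : ℝ) : Continuous (truncEnergy G ρ k) :=
  continuous_setIntegral_closedBall (f := fun x t => max (G x t - k) 0 ^ 2) (by fun_prop) ρ

theorem truncEnergy_nonneg (G : E3 → ℝ → ℝ) (ρ k t : ℝ) : 0 ≤ truncEnergy G ρ k t :=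
  integral_nonneg fun _ => sq_nonneg _

namespace IsSwirl

variable {u : E3 → ℝ → E3} {G : E3 → ℝ → ℝ} {R A C k δ ρ : ℝ} {F F1 F2 : ℝ → ℝ}

theorem integral_cube_le (h : IsSwirl u G R A) (hC : SobolevConst C)
    (hT : Truncation k δ F F1 F2) (hk : 0 < k) {ρ' m : ℝ} (hρ' : 0 < ρ') (hρ : ρ' < ρ)
    (hρR : ρ ≤ R) (hm : 0 < m) :
    ∫ t in (-ρ' ^ 2)..0, ∫ x, F (G x t) ^ 3 * cutoff ρ x ^ 6 ≤
      √((R ^ 8 / (ρ ^ 2 - ρ' ^ 2) + 2 * ((64 + 65536 * C) * (1 + A) ^ 2 * R ^ 6)) *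
        ∫ t in (-ρ ^ 2)..0, truncEnergy G ρ k t) *
      (4 * ((R ^ 8 / (ρ ^ 2 - ρ' ^ 2) + 2 * ((64 + 65536 * C) * (1 + A) ^ 2 * R ^ 6)) *
        ∫ t in (-ρ ^ 2)..0, truncEnergy G ρ k t) / m +
        C * m ^ 3 * (R ^ 8 * ∫ t in (-ρ ^ 2)..0, truncEnergy G ρ k t)) := by
  have hρ0 : 0 < ρ := hρ'.trans hρ
  have hR : 0 < R := hρ0.trans_le hρR
  have hG2 : ∀ t, ContDiff ℝ 2 fun x => G x t := contDiff_slice h.smooth_G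
  have hG1 : ContDiff ℝ 1 fun z : E3 × ℝ => G z.1 z.2 := h.smooth_G.of_le (by norm_num)
  have cG := hG1.continuous
  have cF : Continuous F := hT.contDiff.continuous
  have cF1 : Continuous F1 := hT.contDiff1.continuous
  have cq := continuous_cutoff ρ
  have cp := fun i => continuous_pd_slice hG1 i
  have ct := continuous_deriv_slice hG1
  have z : ∀ x : E3, ρ < ‖x‖ → cutoff ρ x = 0 := fun x hx => cutoff_eq_zero hρ0 hx.le
  have hu : ∀ t i, ContDiff ℝ 1 fun x => u x t i := fun t i =>
    (EuclideanSpace.proj i : E3 →L[ℝ] ℝ).contDiff.comp (contDiff_slice h.smooth_u t)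
  have hA := h.A_nonneg
  have cI : Continuous fun t => ∫ x, F (G x t) ^ 2 * cutoff ρ x ^ 4 := by
    simp only [fun t => integral_eq_setIntegral_closedBall (R := ρ)
      (f := fun x => F (G x t) ^ 2 * cutoff ρ x ^ 4) fun x hx => by simp [z x hx]]
    exact continuous_setIntegral_closedBall (f := fun x t => F (G x t) ^ 2 * cutoff ρ x ^ 4)
      (by fun_prop) ρ
  have cZ : Continuous fun t => ∫ x, F (G x t) ^ 3 * cutoff ρ x ^ 6 := by
    simp only [fun t => integral_eq_setIntegral_closedBall (R := ρ)
      (f := fun x => F (G x t) ^ 3 * cutoff ρ x ^ 6) fun x hx => by simp [z x hx]]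
    exact continuous_setIntegral_closedBall (f := fun x t => F (G x t) ^ 3 * cutoff ρ x ^ 6)
      (by fun_prop) ρ
  have eJ : ∀ t x i, pd (fun y => F (G y t) * cutoff ρ y ^ 2) i x =
      F1 (G x t) * pd (fun y => G y t) i x * cutoff ρ x ^ 2 -
        4 * F (G x t) * cutoff ρ x * x i := fun t x i =>
    (hasPd_truncation_mul_cutoff_sq hT (hG2 t) ρ i x).2
  have cJ : Continuous fun t => ∫ x, ∑ i, pd (fun y => F (G y t) * cutoff ρ y ^ 2) i x ^ 2 := by
    simp only [eJ]
    simp only [fun t => integral_eq_setIntegral_closedBall (R := ρ)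
      (f := fun x => ∑ i, (F1 (G x t) * pd (fun y => G y t) i x * cutoff ρ x ^ 2 -
        4 * F (G x t) * cutoff ρ x * x i) ^ 2) fun x hx => by simp [z x hx]]
    exact continuous_setIntegral_closedBall (f := fun x t =>
      ∑ i, (F1 (G x t) * pd (fun y => G y t) i x * cutoff ρ x ^ 2 -
        4 * F (G x t) * cutoff ρ x * x i) ^ 2) (by fun_prop) ρ
  have hI : ∀ t, HasDerivAt (fun t => ∫ x, F (G x t) ^ 2 * cutoff ρ x ^ 4)
      (∫ x, 2 * F (G x t) * F1 (G x t) * deriv (G x) t * cutoff ρ x ^ 4) t := fun t => by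
    simp only [fun t => integral_eq_setIntegral_closedBall (R := ρ)
      (f := fun x => F (G x t) ^ 2 * cutoff ρ x ^ 4) fun x hx => by simp [z x hx],
      fun t => integral_eq_setIntegral_closedBall (R := ρ)
      (f := fun x => 2 * F (G x t) * F1 (G x t) * deriv (G x) t * cutoff ρ x ^ 4)
      fun x hx => by simp [z x hx]]
    refine hasDerivAt_setIntegral_closedBall (f := fun x t => F (G x t) ^ 2 * cutoff ρ x ^ 4)
      (f' := fun x t => 2 * F (G x t) * F1 (G x t) * deriv (G x) t * cutoff ρ x ^ 4)
      (by fun_prop) (by fun_prop) (fun x t => ?_) ρ t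
    have h1 := (hT.deriv (G x t)).comp t (hasDerivAt_slice hG1 x t).differentiableAt.hasDerivAt
    refine ((h1.pow 2).mul_const (cutoff ρ x ^ 4)).congr_deriv ?_
    simp only [Function.comp_apply, Nat.cast_ofNat]
    ring
  refine integral_le_of_energy_inequality (T := ρ ^ 2) (T' := ρ' ^ 2) (K := R ^ 8) (by positivity)
    (by gcongr) (by positivity) (by have := hC.1; positivity) hC.1.le hm cI cJ
    (continuous_truncEnergy cG ρ k) cZ hI (fun t ht => ?_) (fun t => ?_)
    (fun t => integral_nonneg fun x => by positivity)
    (fun t => integral_nonneg fun x => Finset.sum_nonneg fun i _ => sq_nonneg _)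
    (truncEnergy_nonneg G ρ k) fun t => integral_cube_pow_four_le hC hT (hG2 t) hρ0
  · have ht' : t ∈ Ioo (-R ^ 2) 0 := ⟨lt_of_le_of_lt (by gcongr) ht.1, ht.2⟩
    refine slice_estimate (b := fun i x => u x t i) (β := fun x => ‖u x t‖) hC hT hk (hG2 t) (hu t)
      (fun x => h.axis x t) hρ0 hρR hA (gt := fun x => deriv (G x) t)
      (ct.comp (by fun_prop : Continuous fun x : E3 => (x, t)))
      (fun x hx hr => h.pde x t ht' (hx.trans_le hρR) hr)
      (fun x hx => h.divfree x t ht' (hx.trans_le hρR))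
      (contDiff_slice h.smooth_u t).continuous.norm (fun x => ?_) (h.energy t ht')
    have := abs_real_inner_le_norm (u x t) x
    rw [PiLp.inner_apply] at this
    simpa [mul_comm] using this
  · rw [truncEnergy, ← integral_const_mul]
    have cGt := (hG2 t).continuous
    refine integral_le_of_le_of_eq_zero (by fun_prop) (by fun_prop)
      (fun x hx => by simp [z x hx]) fun x _ => ?_
    have k1 : cutoff ρ x ≤ R ^ 2 := (cutoff_le x).trans (by gcongr)
    have k0 := cutoff_nonneg ρ x
    have k2 := truncation_sq_le hT (G x t)
    calc F (G x t) ^ 2 * cutoff ρ x ^ 4 ≤ max (G x t - k) 0 ^ 2 * (R ^ 2) ^ 4 := by gcongr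
      _ = _ := by ring

theorem truncEnergy_le (hT : Truncation k δ F F1 F2) (hδ : 0 < δ)
    (hG : Continuous fun z : E3 × ℝ => G z.1 z.2) {ρ' : ℝ} (hρ' : 0 < ρ') (hρ : ρ' < ρ) (t : ℝ) :
    (ρ ^ 2 - ρ' ^ 2) ^ 6 * truncEnergy G ρ' (k + δ) t ≤
      2 / δ * ∫ x, F (G x t) ^ 3 * cutoff ρ x ^ 6 := by
  have cF : Continuous F := hT.contDiff.continuous
  have cq := continuous_cutoff ρ
  have cG : Continuous fun x => G x t := hG.comp (by fun_prop : Continuous fun x => (x, t))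
  have hρ0 := hρ'.trans hρ
  have i1 : Integrable fun x => 2 / δ * (F (G x t) ^ 3 * cutoff ρ x ^ 6) :=
    (integrable_mul_cutoff_pow (by fun_prop) hρ0 5).const_mul _
  rw [truncEnergy, ← integral_const_mul, ← integral_const_mul]
  refine le_trans ?_ (setIntegral_le_integral i1 (s := Metric.closedBall 0 ρ')
    (.of_forall fun x => ?_))
  · refine setIntegral_mono_on (ContinuousOn.integrableOn_compact
      (isCompact_closedBall _ _) (by fun_prop)) i1.integrableOn measurableSet_closedBall fun x hx => ?_
    have hx' : ‖x‖ ≤ ρ' := by simpa using hx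
    have h1 : ρ ^ 2 - ρ' ^ 2 ≤ cutoff ρ x := le_max_of_le_left (by gcongr)
    have h2 : 0 ≤ ρ ^ 2 - ρ' ^ 2 := by nlinarith
    have h3 := hT.trunc_sq_le (G x t)
    have h4 := hT.nonneg (G x t)
    calc (ρ ^ 2 - ρ' ^ 2) ^ 6 * max (G x t - (k + δ)) 0 ^ 2 ≤
        cutoff ρ x ^ 6 * (2 / δ * F (G x t) ^ 3) := by gcongr
      _ = _ := by ring
  · have h4 := hT.nonneg (G x t)
    have k0 := cutoff_nonneg ρ x
    simp only [Pi.zero_apply]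
    positivity

end IsSwirl

/-- The constant in the one-step estimate of the De Giorgi iteration. -/
def stepConst (C : ℝ) : ℝ := 2 * (129 + 131072 * C) * (4 * (129 + 131072 * C) + C)

theorem step_arithmetic {C R A a e δ Y X : ℝ} (hC : 0 < C) (hR : 0 < R) (hA : 0 ≤ A)
    (ha : 0 < a) (ha4 : a ^ 4 = ((1 + A) / R) ^ 2) (he : 0 < e) (he1 : e ≤ 1) (hδ : 0 < δ)
    (hY : 0 ≤ Y) (hX : (e * R ^ 2) ^ 6 * X ≤ 2 / δ *
      (√((R ^ 8 / (e * R ^ 2) + 2 * ((64 + 65536 * C) * (1 + A) ^ 2 * R ^ 6)) * Y) *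
      (4 * ((R ^ 8 / (e * R ^ 2) + 2 * ((64 + 65536 * C) * (1 + A) ^ 2 * R ^ 6)) * Y) / a +
        C * a ^ 3 * (R ^ 8 * Y)))) :
    X ≤ stepConst C * a ^ 5 / (e ^ 8 * δ) * (Y * √Y) := by
  have h1 : (1 + A) ^ 2 = a ^ 4 * R ^ 2 := by
    rw [ha4]
    field_simp
  have h2 : 1 ≤ a ^ 4 * R ^ 2 := by
    rw [← h1]
    nlinarith
  set E := 129 + 131072 * C with hE
  have hE1 : 1 ≤ E / e := by
    rw [one_le_div he]
    linarith
  have hE0 : 0 < E := by positivity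
  have h3 : R ^ 8 / (e * R ^ 2) + 2 * ((64 + 65536 * C) * (1 + A) ^ 2 * R ^ 6) ≤
      R ^ 8 * a ^ 4 * (E / e) := by
    have e1 : R ^ 8 / (e * R ^ 2) ≤ R ^ 8 * a ^ 4 * (1 / e) := by
      rw [show R ^ 8 / (e * R ^ 2) = R ^ 6 * 1 * (1 / e) by field_simp,
        show R ^ 8 * a ^ 4 * (1 / e) = R ^ 6 * (a ^ 4 * R ^ 2) * (1 / e) by ring]
      gcongr
    have e2 : 2 * ((64 + 65536 * C) * (1 + A) ^ 2 * R ^ 6) ≤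
        R ^ 8 * a ^ 4 * ((128 + 131072 * C) / e) := by
      rw [h1, show 2 * ((64 + 65536 * C) * (a ^ 4 * R ^ 2) * R ^ 6) =
        R ^ 8 * a ^ 4 * (128 + 131072 * C) by ring]
      gcongr
      exact le_div_self (by positivity) he he1
    calc _ ≤ _ := add_le_add e1 e2
      _ = _ := by rw [hE]; ring
  set B := R ^ 8 / (e * R ^ 2) + 2 * ((64 + 65536 * C) * (1 + A) ^ 2 * R ^ 6)
  have h4 : √(B * Y) ≤ R ^ 4 * a ^ 2 * (E / e) * √Y := by
    rw [Real.sqrt_le_left (by positivity), mul_pow, Real.sq_sqrt hY]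
    gcongr
    calc B ≤ R ^ 8 * a ^ 4 * ((E / e) * 1) := by rwa [mul_one]
      _ ≤ R ^ 8 * a ^ 4 * ((E / e) * (E / e)) := by gcongr
      _ = _ := by ring
  have h5 : 4 * (B * Y) / a + C * a ^ 3 * (R ^ 8 * Y) ≤
      R ^ 8 * a ^ 3 * ((4 * E + C) / e) * Y := by
    have e1 : 4 * (B * Y) / a ≤ 4 * ((R ^ 8 * a ^ 4 * (E / e)) * Y) / a := by gcongr
    have e2 : C ≤ C / e := le_div_self hC.le he he1
    have e3 : C * a ^ 3 * (R ^ 8 * Y) ≤ C / e * a ^ 3 * (R ^ 8 * Y) := by gcongr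
    refine (add_le_add e1 e3).trans_eq ?_
    field_simp
  have hB : 0 ≤ B := by positivity
  have h6 : (e * R ^ 2) ^ 6 * X ≤ (e * R ^ 2) ^ 6 *
      (stepConst C * a ^ 5 / (e ^ 8 * δ) * (Y * √Y)) := by
    calc _ ≤ 2 / δ * ((R ^ 4 * a ^ 2 * (E / e) * √Y) *
          (R ^ 8 * a ^ 3 * ((4 * E + C) / e) * Y)) := hX.trans (by gcongr)
      _ = _ := by
        rw [stepConst, ← hE]
        field_simp
  exact le_of_mul_le_mul_left h6 (by positivity)

theorem le_geometric_of_nonlinear_recurrence {Y : ℕ → ℝ} {D : ℝ} (h0 : ∀ n, 0 ≤ Y n) (hD : 0 ≤ D)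
    (hrec : ∀ n, Y (n + 1) ≤ D * (2 ^ 9) ^ n * (Y n * √(Y n)))
    (hsmall : D * √(Y 0) * 2 ^ 18 ≤ 1) (n : ℕ) : Y n ≤ Y 0 * ((1 / 2 ^ 9) ^ n) ^ 2 := by
  induction n with
  | zero => simp
  | succ n ih =>
    have h1 : √(Y n) ≤ √(Y 0) * (1 / 2 ^ 9) ^ n := by
      rw [Real.sqrt_le_left (by positivity), mul_pow, Real.sq_sqrt (h0 0)]
      exact ih
    have h2 : (2 ^ 9 : ℝ) ^ n * (1 / 2 ^ 9) ^ n = 1 := by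
      rw [← mul_pow]
      norm_num
    have y0 := h0 0
    calc Y (n + 1) ≤ D * (2 ^ 9) ^ n * (Y 0 * ((1 / 2 ^ 9) ^ n) ^ 2 *
          (√(Y 0) * (1 / 2 ^ 9) ^ n)) := by
          refine (hrec n).trans ?_
          have := h0 n
          gcongr
      _ = (D * √(Y 0) * 2 ^ 18) * (Y 0 * ((1 / 2 ^ 9) ^ n) ^ 2 * (1 / 2 ^ 18)) *
          ((2 ^ 9 : ℝ) ^ n * (1 / 2 ^ 9) ^ n) := by ring
      _ ≤ 1 * (Y 0 * ((1 / 2 ^ 9) ^ n) ^ 2 * (1 / 2 ^ 18)) * 1 := by rw [h2]; gcongr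
      _ = _ := by ring

theorem tendsto_geometric_sq (y : ℝ) :
    Filter.Tendsto (fun n : ℕ => y * (((1 : ℝ) / 2 ^ 9) ^ n) ^ 2) Filter.atTop (nhds 0) := by
  have := tendsto_pow_atTop_nhds_zero_of_lt_one (r := (1 : ℝ) / 2 ^ 9) (by norm_num) (by norm_num)
  simpa using (this.pow 2).const_mul y

theorem eq_zero_of_setIntegral_eq_zero {X : Type*} [TopologicalSpace X] [MeasurableSpace X]
    [OpensMeasurableSpace X] {μ : Measure X} [μ.IsOpenPosMeasure] {f : X → ℝ} (hf : Continuous f)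
    (h0 : ∀ x, 0 ≤ f x) {s U : Set X} (hs : IntegrableOn f s μ) (hU : IsOpen U) (hUs : U ⊆ s)
    (h : ∫ x in s, f x ∂μ ≤ 0) {x : X} (hx : x ∈ U) : f x = 0 := by
  have h1 : ∫ x in s, f x ∂μ = 0 := le_antisymm h (integral_nonneg h0)
  rw [integral_eq_zero_iff_of_nonneg h0 hs] at h1
  have h2 : f =ᵐ[μ.restrict U] fun _ => 0 := ae_restrict_of_ae_restrict_of_subset hUs h1
  exact Measure.eqOn_open_of_ae_eq h2 hU hf.continuousOn continuousOn_const hx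

theorem truncEnergy_mono {G : E3 → ℝ → ℝ} (hG : Continuous fun z : E3 × ℝ => G z.1 z.2)
    {ρ ρ' k k' : ℝ} (hρ : ρ ≤ ρ') (hk : k' ≤ k) (t : ℝ) :
    truncEnergy G ρ k t ≤ truncEnergy G ρ' k' t := by
  have cG : Continuous fun x => G x t := hG.comp (by fun_prop : Continuous fun x => (x, t))
  have int : ∀ r k, IntegrableOn (fun x => max (G x t - k) 0 ^ 2) (Metric.closedBall 0 r) :=
    fun r k => ContinuousOn.integrableOn_compact (isCompact_closedBall _ _) (by fun_prop)
  refine (setIntegral_mono (int ρ k) (int ρ k') fun x => ?_).trans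
    (setIntegral_mono_set (int ρ' k') (.of_forall fun x => sq_nonneg _)
      (Metric.closedBall_subset_closedBall hρ).eventuallyLE)
  simp only
  gcongr

theorem integral_truncEnergy_mono {G : E3 → ℝ → ℝ} (hG : Continuous fun z : E3 × ℝ => G z.1 z.2)
    {ρ ρ' k k' : ℝ} (hρ0 : 0 ≤ ρ) (hρ : ρ ≤ ρ') (hk : k' ≤ k) :
    ∫ t in (-ρ ^ 2)..0, truncEnergy G ρ k t ≤ ∫ t in (-ρ' ^ 2)..0, truncEnergy G ρ' k' t := by
  have c := continuous_truncEnergy hG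
  have h0 : -ρ ^ 2 ≤ 0 := by nlinarith
  have h1 : -ρ' ^ 2 ≤ -ρ ^ 2 := by nlinarith
  exact (intervalIntegral.integral_mono_on h0 ((c ρ k).intervalIntegrable _ _)
    ((c ρ' k').intervalIntegrable _ _) fun t _ => truncEnergy_mono hG hρ hk t).trans
    (intervalIntegral.integral_mono_interval h1 h0 le_rfl
      (.of_forall (truncEnergy_nonneg G ρ' k')) ((c ρ' k').intervalIntegrable _ _))

theorem le_of_integral_truncEnergy_le {G : E3 → ℝ → ℝ}
    (hG : Continuous fun z : E3 × ℝ => G z.1 z.2) {ρ k : ℝ}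
    (h : ∫ t in (-ρ ^ 2)..0, truncEnergy G ρ k t ≤ 0) {x : E3} (hx : ‖x‖ < ρ) {t : ℝ}
    (ht : t ∈ Ioo (-ρ ^ 2) 0) : G x t ≤ k := by
  have cG : Continuous fun x => G x t := hG.comp (by fun_prop : Continuous fun x => (x, t))
  have c := continuous_truncEnergy hG ρ k
  rw [intervalIntegral.integral_of_le (ht.1.trans ht.2).le] at h
  have h1 := eq_zero_of_setIntegral_eq_zero c (truncEnergy_nonneg G ρ k)
    (c.continuousOn.integrableOn_compact isCompact_Icc |>.mono_set Ioc_subset_Icc_self) isOpen_Ioo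
    Ioo_subset_Ioc_self h ht
  have h2 := eq_zero_of_setIntegral_eq_zero (μ := (volume : Measure E3))
    (f := fun x => max (G x t - k) 0 ^ 2) (by fun_prop) (fun x => sq_nonneg _)
    (ContinuousOn.integrableOn_compact (isCompact_closedBall 0 ρ) (by fun_prop))
    Metric.isOpen_ball Metric.ball_subset_closedBall h1.le (x := x) (by simpa using hx)
  have h3 : max (G x t - k) 0 = 0 := by simpa using h2
  linarith [le_max_left (G x t - k) 0]

namespace IsSwirl

variable {u : E3 → ℝ → E3} {G : E3 → ℝ → ℝ} {R A C : ℝ}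

theorem step (h : IsSwirl u G R A) (hC : SobolevConst C) {k δ ρ ρ' e a : ℝ} (hk : 0 < k)
    (hδ : 0 < δ) (hρ' : 0 < ρ') (hρR : ρ ≤ R) (hρ0 : 0 < ρ) (he : 0 < e) (he1 : e ≤ 1)
    (hd : ρ ^ 2 - ρ' ^ 2 = e * R ^ 2) (ha : 0 < a) (ha4 : a ^ 4 = ((1 + A) / R) ^ 2) :
    ∫ t in (-ρ' ^ 2)..0, truncEnergy G ρ' (k + δ) t ≤ stepConst C * a ^ 5 / (e ^ 8 * δ) *
      ((∫ t in (-ρ ^ 2)..0, truncEnergy G ρ k t) *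
        √(∫ t in (-ρ ^ 2)..0, truncEnergy G ρ k t)) := by
  obtain ⟨F, F1, F2, hT⟩ := exists_truncation k hδ
  have hR : 0 < R := hρ0.trans_le hρR
  have hρ : ρ' < ρ := by
    have : 0 < e * R ^ 2 := by positivity
    exact lt_of_pow_lt_pow_left₀ 2 hρ0.le (by linarith)
  have cG := h.smooth_G.continuous
  have hn : ∀ r : ℝ, -r ^ 2 ≤ 0 := fun r => by nlinarith
  refine step_arithmetic hC.1 hR h.A_nonneg ha ha4 he he1 hδ
    (intervalIntegral.integral_nonneg (hn ρ) fun t _ => truncEnergy_nonneg G ρ k t) ?_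
  have h1 := h.integral_cube_le hC hT hk hρ' hρ hρR ha
  rw [hd] at h1
  refine le_trans ?_ (mul_le_mul_of_nonneg_left h1 (by positivity))
  rw [← intervalIntegral.integral_const_mul, ← intervalIntegral.integral_const_mul]
  have cF : Continuous F := hT.contDiff.continuous
  have cq := continuous_cutoff ρ
  have cZ : Continuous fun t => ∫ x, F (G x t) ^ 3 * cutoff ρ x ^ 6 := by
    simp only [fun t => integral_eq_setIntegral_closedBall (R := ρ)
      (f := fun x => F (G x t) ^ 3 * cutoff ρ x ^ 6)
      fun x hx => by simp [cutoff_eq_zero hρ0 hx.le]]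
    exact continuous_setIntegral_closedBall (f := fun x t => F (G x t) ^ 3 * cutoff ρ x ^ 6)
      (by fun_prop) ρ
  refine intervalIntegral.integral_mono_on (hn ρ')
    (((continuous_truncEnergy cG ρ' (k + δ)).intervalIntegrable _ _).const_mul _)
    ((cZ.intervalIntegrable _ _).const_mul _) fun t _ => ?_
  rw [← hd]
  exact truncEnergy_le hT hδ cG hρ' hρ t

theorem le_of_level_ge (h : IsSwirl u G R A) (hC : SobolevConst C) (hR : 0 < R) {a κ : ℝ}
    (ha : 0 < a) (ha4 : a ^ 4 = ((1 + A) / R) ^ 2) (hκ : 0 < κ)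
    (hκS : 2 ^ 19 * (8 / 3) ^ 8 * stepConst C * a ^ 5 *
      √(∫ t in (-R ^ 2)..0, truncEnergy G R 0 t) ≤ κ)
    {x : E3} (hx : ‖x‖ < R / 2) {t : ℝ} (ht : t ∈ Ioo (-(R / 2) ^ 2) 0) : G x t ≤ 2 * κ := by
  have cG := h.smooth_G.continuous
  have hs : 0 < stepConst C := by
    have := hC.1
    unfold stepConst
    positivity
  set ρ : ℕ → ℝ := fun n => √(R ^ 2 * (1 / 4 + 3 / 4 * (1 / 2) ^ n)) with hρ
  set k : ℕ → ℝ := fun n => κ * (2 - (1 / 2) ^ n) with hk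
  set Y : ℕ → ℝ := fun n => ∫ t in (-ρ n ^ 2)..0, truncEnergy G (ρ n) (k n) t with hY
  have hp : ∀ n : ℕ, 0 < (1 / 2 : ℝ) ^ n ∧ (1 / 2 : ℝ) ^ n ≤ 1 := fun n =>
    ⟨by positivity, pow_le_one₀ (by norm_num) (by norm_num)⟩
  have hρ2 : ∀ n, ρ n ^ 2 = R ^ 2 * (1 / 4 + 3 / 4 * (1 / 2) ^ n) := fun n =>
    Real.sq_sqrt (by positivity)
  have hρ0 : ∀ n, 0 < ρ n := fun n => Real.sqrt_pos.mpr (by positivity)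
  have hρR : ∀ n, ρ n ≤ R := fun n => by
    refine le_of_pow_le_pow_left₀ two_ne_zero hR.le ?_
    rw [hρ2]
    nlinarith [(hp n).2, sq_nonneg R]
  have hρh : ∀ n, R / 2 ≤ ρ n := fun n => by
    refine le_of_pow_le_pow_left₀ two_ne_zero (hρ0 n).le ?_
    rw [hρ2]
    nlinarith [(hp n).1, sq_nonneg R, mul_nonneg (sq_nonneg R) (hp n).1.le]
  have hk0 : ∀ n, 0 < k n := fun n => mul_pos hκ (by linarith [(hp n).2])
  have hY0 : ∀ n, 0 ≤ Y n := fun n =>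
    intervalIntegral.integral_nonneg (by nlinarith [hρ0 n]) fun t _ => truncEnergy_nonneg G _ _ t
  set D := 2 * (8 / 3) ^ 8 * stepConst C * a ^ 5 / κ with hD
  have hrec : ∀ n, Y (n + 1) ≤ D * (2 ^ 9) ^ n * (Y n * √(Y n)) := fun n => by
    have e1 : k (n + 1) = k n + κ * (1 / 2) ^ (n + 1) := by
      simp only [hk]
      ring
    have := h.step hC (k := k n) (δ := κ * (1 / 2) ^ (n + 1)) (ρ := ρ n) (ρ' := ρ (n + 1))
      (e := 3 / 8 * (1 / 2) ^ n) (hk0 n) (by positivity) (hρ0 _) (hρR n) (hρ0 n) (by positivity)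
      (by linarith [(hp n).2]) (by rw [hρ2, hρ2]; ring) ha ha4
    rw [← e1] at this
    refine this.trans_eq ?_
    simp only [hY]
    congr 1
    rw [hD]
    simp only [one_div, inv_pow]
    rw [← pow_mul]
    field_simp
    ring
  have hsmall : D * √(Y 0) * 2 ^ 18 ≤ 1 := by
    have e1 : √(Y 0) ≤ √(∫ t in (-R ^ 2)..0, truncEnergy G R 0 t) :=
      Real.sqrt_le_sqrt (integral_truncEnergy_mono cG (hρ0 0).le (hρR 0) (hk0 0).le)
    calc D * √(Y 0) * 2 ^ 18 ≤ D * √(∫ t in (-R ^ 2)..0, truncEnergy G R 0 t) * 2 ^ 18 := by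
          gcongr
      _ = (2 ^ 19 * (8 / 3) ^ 8 * stepConst C * a ^ 5 *
          √(∫ t in (-R ^ 2)..0, truncEnergy G R 0 t)) / κ := by rw [hD]; ring
      _ ≤ 1 := (div_le_one hκ).mpr hκS
  have hgeo := le_geometric_of_nonlinear_recurrence hY0 (by positivity) hrec hsmall
  refine le_of_integral_truncEnergy_le cG ?_ hx ht
  refine ge_of_tendsto' (tendsto_geometric_sq (Y 0)) fun n => ?_
  refine le_trans (integral_truncEnergy_mono cG (by positivity) (hρh n) ?_) (hgeo n)
  simp only [hk]
  nlinarith [(hp n).1]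

theorem local_bound (h : IsSwirl u G R A) (hC : SobolevConst C) (hR : 0 < R) {a : ℝ}
    (ha : 0 < a) (ha4 : a ^ 4 = ((1 + A) / R) ^ 2)
    {x : E3} (hx : ‖x‖ < R / 2) {t : ℝ} (ht : t ∈ Ioo (-(R / 2) ^ 2) 0) :
    G x t ≤ 2 ^ 20 * (8 / 3) ^ 8 * stepConst C * a ^ 5 *
      √(∫ t in (-R ^ 2)..0, truncEnergy G R 0 t) := by
  have hs : 0 < stepConst C := by
    have := hC.1
    unfold stepConst
    positivity
  refine le_of_forall_pos_le_add fun ε hε => ?_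
  have h0 : 0 ≤ 2 ^ 19 * (8 / 3) ^ 8 * stepConst C * a ^ 5 *
      √(∫ t in (-R ^ 2)..0, truncEnergy G R 0 t) := by positivity
  have := h.le_of_level_ge hC hR ha ha4 (κ := 2 ^ 19 * (8 / 3) ^ 8 * stepConst C * a ^ 5 *
      √(∫ t in (-R ^ 2)..0, truncEnergy G R 0 t) + ε / 2) (by positivity) (by linarith) hx ht
  linarith

end IsSwirl

section Globalization

open scoped Topology Manifold ContDiff

variable {E F : Type*} [NormedAddCommGroup E] [NormedSpace ℝ E] [FiniteDimensional ℝ E]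
  [NormedAddCommGroup F] [NormedSpace ℝ F]

theorem exists_smooth_cutoff {K U : Set E} (hK : IsCompact K) (hU : IsOpen U) (hKU : K ⊆ U) :
    ∃ (χ : E → ℝ) (W : Set E), ContDiff ℝ ∞ χ ∧ IsOpen W ∧ K ⊆ W ∧ W ⊆ U ∧
      (∀ z ∈ W, χ z = 1) ∧ tsupport χ ⊆ U := by
  obtain ⟨L, hL, hKL, hLU⟩ := exists_compact_between hK hU hKU
  obtain ⟨χ, h1, h0, -⟩ := exists_contMDiffMap_one_nhds_of_subset_interior 𝓘(ℝ, E) (n := ⊤)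
    hK.isClosed hKL
  obtain ⟨V, hV, hKV, hV1⟩ := mem_nhdsSet_iff_exists.1 h1
  refine ⟨χ, V ∩ U, χ.contMDiff.contDiff, hV.inter hU, subset_inter hKV hKU, inter_subset_right,
    fun z hz => hV1 hz.1, ?_⟩
  refine (closure_minimal (fun z hz => ?_) hL.isClosed).trans hLU
  by_contra h
  exact hz (h0 z h)

theorem ContDiffOn.exists_contDiff_eqOn {f : E → F} {K U : Set E} (hf : ContDiffOn ℝ ∞ f U)
    (hK : IsCompact K) (hU : IsOpen U) (hKU : K ⊆ U) :
    ∃ (g : E → F) (W : Set E), ContDiff ℝ ∞ g ∧ IsOpen W ∧ K ⊆ W ∧ W ⊆ U ∧ EqOn g f W := by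
  obtain ⟨χ, W, hχ, hW, hKW, hWU, h1, hs⟩ := exists_smooth_cutoff hK hU hKU
  refine ⟨fun z => χ z • f z, W, contDiff_iff_contDiffAt.2 fun z => ?_, hW, hKW, hWU,
    fun z hz => by simp [h1 z hz]⟩
  by_cases hz : z ∈ U
  · exact hχ.contDiffAt.smul (hf.contDiffAt (hU.mem_nhds hz))
  · have : (fun z => χ z • f z) =ᶠ[𝓝 z] fun _ => 0 := by
      filter_upwards [notMem_tsupport_iff_eventuallyEq.1 fun h => hz (hs h)] with y hy
      simp [hy]
    exact contDiffAt_const.congr_of_eventuallyEq this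

end Globalization

section Congruence

open scoped Topology

variable {W : Set (E3 × ℝ)} {f g : E3 → ℝ → ℝ} {x : E3} {t : ℝ}

theorem eventually_slice (hW : IsOpen W) (h : (x, t) ∈ W) : ∀ᶠ y in 𝓝 x, (y, t) ∈ W :=
  (by fun_prop : Continuous fun y : E3 => (y, t)).continuousAt.eventually (hW.mem_nhds h)

theorem pd_congr {f g : E3 → ℝ} (h : f =ᶠ[𝓝 x] g) (i : Fin 3) : pd f i x = pd g i x := by
  rw [pd, pd, h.fderiv_eq]

theorem lap_congr {f g : E3 → ℝ} (h : f =ᶠ[𝓝 x] g) : lap f x = lap g x :=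
  Finset.sum_congr rfl fun i _ => pd_congr (h.eventuallyEq_nhds.mono fun _ hy => pd_congr hy i) i

theorem deriv_slice_congr (hW : IsOpen W) (hfg : ∀ x t, (x, t) ∈ W → f x t = g x t)
    (h : (x, t) ∈ W) : deriv (f x) t = deriv (g x) t := by
  refine Filter.EventuallyEq.deriv_eq ?_
  filter_upwards [(by fun_prop : Continuous fun s : ℝ => (x, s)).continuousAt.eventually
    (hW.mem_nhds h)] with s hs using hfg x s hs

theorem IsNSQ1.congr {u v : E3 → ℝ → E3} {P : E3 → ℝ → ℝ} {U : Set (E3 × ℝ)} (h : IsNSQ1 u P U)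
    (hW : IsOpen W) (hQ : closure (Qyl (0, 0) 1) ⊆ W) (hWU : W ⊆ U)
    (hv : ∀ x t, (x, t) ∈ W → v x t = u x t) : IsNSQ1 v P W := by
  have e : ∀ x t, (x, t) ∈ W → ∀ j, (fun y => v y t j) =ᶠ[𝓝 x] fun y => u y t j :=
    fun x t hx j => (eventually_slice hW hx).mono fun y hy => by simp [hv y t hy]
  refine ⟨hW, hQ, (h.smooth_u.mono hWU).congr fun z hz => hv _ _ hz, h.smooth_P.mono hWU,
    fun x t hx j => ?_, fun x t hx => ?_⟩
  · rw [← h.momentum x t (hWU hx) j, lap_congr (e x t hx j),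
      deriv_slice_congr (f := fun x s => v x s j) (g := fun x s => u x s j) hW
        (fun y s hy => by simp [hv y s hy]) hx]
    simp only [pd_congr (e x t hx j), hv x t hx]
  · rw [← h.divfree x t (hWU hx)]
    exact Finset.sum_congr rfl fun i _ => pd_congr (e x t hx i) i

theorem IsAxisym.congr {u v : E3 → ℝ → E3} {P : E3 → ℝ → ℝ} {U : Set (E3 × ℝ)}
    (h : IsAxisym u P U) (hWU : W ⊆ U) (hv : ∀ x t, (x, t) ∈ W → v x t = u x t) :
    IsAxisym v P W := by
  obtain ⟨ur, uθ, u3, pp, h⟩ := h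
  refine ⟨ur, uθ, u3, pp, fun x t hx hr => ?_⟩
  rw [hv x t hx]
  exact h x t (hWU hx) hr

end Congruence

section Rotation

open scoped Topology

/-- Rotation of `x` by the angle `s` about the `x₃`-axis. -/
def rot (x : E3) (s : ℝ) : E3 :=
  x + ((cos s - 1) * x 0 - sin s * x 1) • ee 0 + (sin s * x 0 + (cos s - 1) * x 1) • ee 1

variable {x : E3} {t : ℝ}

@[simp] theorem rot_zero (x : E3) : rot x 0 = x := by simp [rot]

theorem rot_apply_zero (x : E3) (s : ℝ) : rot x s 0 = cos s * x 0 - sin s * x 1 := by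
  simp [rot, ee]; ring

theorem rot_apply_one (x : E3) (s : ℝ) : rot x s 1 = sin s * x 0 + cos s * x 1 := by
  simp [rot, ee]; ring

theorem rot_apply_two (x : E3) (s : ℝ) : rot x s 2 = x 2 := by
  simp [rot, ee]

theorem rot_radius (x : E3) (s : ℝ) : rot x s 0 ^ 2 + rot x s 1 ^ 2 = x 0 ^ 2 + x 1 ^ 2 := by
  rw [rot_apply_zero, rot_apply_one]
  linear_combination (x 0 ^ 2 + x 1 ^ 2) * sin_sq_add_cos_sq s

theorem continuous_rot (x : E3) : Continuous (rot x) := by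
  unfold rot
  fun_prop

theorem hasDerivAt_rot (x : E3) : HasDerivAt (rot x) (-x 1 • ee 0 + x 0 • ee 1) 0 := by
  have hc := hasDerivAt_cos 0
  have hs := hasDerivAt_sin 0
  have h0 := ((hc.sub_const 1).mul_const (x 0)).sub (hs.mul_const (x 1))
  have h1 := (hs.mul_const (x 0)).add ((hc.sub_const 1).mul_const (x 1))
  refine (((h0.smul_const (ee 0)).const_add x).add (h1.smul_const (ee 1))).congr_deriv ?_
  simp

theorem hasDerivAt_comp_rot {f : E3 → ℝ} (hf : DifferentiableAt ℝ f x) :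
    HasDerivAt (fun s => f (rot x s)) (x 0 * pd f 1 x - x 1 * pd f 0 x) 0 := by
  have hf' : HasFDerivAt f (fderiv ℝ f x) (rot x 0) := by simpa using hf.hasFDerivAt
  refine (hf'.comp_hasDerivAt 0 (hasDerivAt_rot x)).congr_deriv ?_
  simp [pd]
  ring

theorem IsAxisym.rot {u : E3 → ℝ → E3} {P : E3 → ℝ → ℝ} {W : Set (E3 × ℝ)} (h : IsAxisym u P W)
    (hx : (x, t) ∈ W) (hr : x 0 ^ 2 + x 1 ^ 2 ≠ 0) {s : ℝ} (hs : (rot x s, t) ∈ W) :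
    u (rot x s) t 0 = cos s * u x t 0 - sin s * u x t 1 ∧
      u (rot x s) t 1 = sin s * u x t 0 + cos s * u x t 1 ∧ P (rot x s) t = P x t := by
  obtain ⟨ur, uθ, u3, pp, h⟩ := h
  obtain ⟨h0, h1, -, hP⟩ := h x t hx hr
  obtain ⟨k0, k1, -, kP⟩ := h (_root_.rot x s) t hs (by rwa [rot_radius])
  rw [k0, k1, kP, h0, h1, hP, rot_radius, rot_apply_two, rot_apply_zero, rot_apply_one]
  refine ⟨by ring, by ring, rfl⟩

variable {u : E3 → ℝ → E3} {P : E3 → ℝ → ℝ} {W : Set (E3 × ℝ)}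

theorem IsAxisym.eventually_rot (h : IsAxisym u P W) (hW : IsOpen W) (hx : (x, t) ∈ W)
    (hr : x 0 ^ 2 + x 1 ^ 2 ≠ 0) : ∀ᶠ s in 𝓝 (0 : ℝ),
    u (_root_.rot x s) t 0 = cos s * u x t 0 - sin s * u x t 1 ∧
      u (_root_.rot x s) t 1 = sin s * u x t 0 + cos s * u x t 1 ∧
      P (_root_.rot x s) t = P x t := by
  have c : Continuous fun s => (_root_.rot x s, t) := (continuous_rot x).prodMk continuous_const
  have : W ∈ 𝓝 (_root_.rot x 0, t) := by simpa using hW.mem_nhds hx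
  exact (c.continuousAt.eventually this).mono fun s hs => h.rot hx hr hs

theorem IsAxisym.angular_derivatives (h : IsAxisym u P W) (hW : IsOpen W) (hx : (x, t) ∈ W)
    (hr : x 0 ^ 2 + x 1 ^ 2 ≠ 0) (hu : ∀ j, DifferentiableAt ℝ (fun y => u y t j) x)
    (hP : DifferentiableAt ℝ (fun y => P y t) x) :
    x 0 * pd (fun y => u y t 0) 1 x - x 1 * pd (fun y => u y t 0) 0 x = -u x t 1 ∧
      x 0 * pd (fun y => u y t 1) 1 x - x 1 * pd (fun y => u y t 1) 0 x = u x t 0 ∧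
      x 0 * pd (fun y => P y t) 1 x - x 1 * pd (fun y => P y t) 0 x = 0 := by
  have e := h.eventually_rot hW hx hr
  have hc := hasDerivAt_cos 0
  have hs := hasDerivAt_sin 0
  refine ⟨(hasDerivAt_comp_rot (hu 0)).unique ?_, (hasDerivAt_comp_rot (hu 1)).unique ?_,
    (hasDerivAt_comp_rot hP).unique ?_⟩
  · refine HasDerivAt.congr_of_eventuallyEq ?_ (e.mono fun s hs => hs.1)
    exact ((hc.mul_const (u x t 0)).sub (hs.mul_const (u x t 1))).congr_deriv (by simp)
  · refine HasDerivAt.congr_of_eventuallyEq ?_ (e.mono fun s hs => hs.2.1)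
    exact ((hs.mul_const (u x t 0)).add (hc.mul_const (u x t 1))).congr_deriv (by simp)
  · exact (hasDerivAt_const (0 : ℝ) (P x t)).congr_of_eventuallyEq (e.mono fun s hs => hs.2.2)

end Rotation

section SwirlEquation

open scoped ContDiff

variable {x : E3} {t : ℝ} {u : E3 → ℝ → E3} {P : E3 → ℝ → ℝ} {W : Set (E3 × ℝ)}

theorem contDiff_apply_slice {n : WithTop ℕ∞} (hu : ContDiff ℝ n fun z : E3 × ℝ => u z.1 z.2)
    (t : ℝ) (j : Fin 3) : ContDiff ℝ n fun y => u y t j :=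
  (EuclideanSpace.proj j : E3 →L[ℝ] ℝ).contDiff.comp (contDiff_slice hu t)

theorem hasPd_Gam (hu : ContDiff ℝ 2 fun z : E3 × ℝ => u z.1 z.2) (t : ℝ) (i : Fin 3) (x : E3) :
    HasPd (fun y => Gam u y t)
      (((if 0 = i then 1 else 0) * u x t 1 + x 0 * pd (fun y => u y t 1) i x) -
        ((if 1 = i then 1 else 0) * u x t 0 + x 1 * pd (fun y => u y t 0) i x)) i x := by
  have d : ∀ j, HasPd (fun y => u y t j) _ i x := fun j => HasPd.of_differentiableAt
    ((contDiff_apply_slice hu t j).differentiable (by norm_num) x)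
  exact ((HasPd.coord 0).mul (d 1)).sub ((HasPd.coord 1).mul (d 0))

theorem lap_Gam (hu : ContDiff ℝ 2 fun z : E3 × ℝ => u z.1 z.2) (t : ℝ) (x : E3) :
    lap (fun y => Gam u y t) x =
      x 0 * lap (fun y => u y t 1) x - x 1 * lap (fun y => u y t 0) x +
        2 * (pd (fun y => u y t 1) 0 x - pd (fun y => u y t 0) 1 x) := by
  have d : ∀ i j, HasPd (fun y => u y t j) _ i x := fun i j => HasPd.of_differentiableAt
    ((contDiff_apply_slice hu t j).differentiable (by norm_num) x)
  have d2 : ∀ i j, HasPd (fun y => pd (fun y => u y t j) i y) _ i x := fun i j =>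
    HasPd.of_differentiableAt ((contDiff_pd (m := 1) (contDiff_apply_slice hu t j)
      (by norm_num) i).differentiable (by norm_num) x)
  have h : ∀ i, pd (fun y => pd (fun y => Gam u y t) i y) i x =
      (0 * u x t 1 + (if 0 = i then 1 else 0) * pd (fun y => u y t 1) i x +
        ((if 0 = i then 1 else 0) * pd (fun y => u y t 1) i x +
          x 0 * pd (fun y => pd (fun y => u y t 1) i y) i x)) -
      (0 * u x t 0 + (if 1 = i then 1 else 0) * pd (fun y => u y t 0) i x +
        ((if 1 = i then 1 else 0) * pd (fun y => u y t 0) i x +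
          x 1 * pd (fun y => pd (fun y => u y t 0) i y) i x)) := fun i => by
    rw [funext fun y => (hasPd_Gam hu t i y).2]
    exact ((((HasPd.const _).mul (d i 1)).add ((HasPd.coord 0).mul (d2 i 1))).sub
      (((HasPd.const _).mul (d i 0)).add ((HasPd.coord 1).mul (d2 i 0)))).2
  simp only [lap, h, Fin.sum_univ_three]
  simp
  ring

theorem swirl_equation (hu : ContDiff ℝ 2 fun z : E3 × ℝ => u z.1 z.2) (hNS : IsNSQ1 u P W)
    (hax : IsAxisym u P W) (hx : (x, t) ∈ W) (hr : x 0 ^ 2 + x 1 ^ 2 ≠ 0) :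
    (x 0 ^ 2 + x 1 ^ 2) * (deriv (Gam u x) t + ∑ i, u x t i * pd (fun y => Gam u y t) i x
      - lap (fun y => Gam u y t) x)
      + 2 * (x 0 * pd (fun y => Gam u y t) 0 x + x 1 * pd (fun y => Gam u y t) 1 x) = 0 := by
  have hP : DifferentiableAt ℝ (fun y => P y t) x :=
    ((hNS.smooth_P.contDiffAt (hNS.open_U.mem_nhds hx)).differentiableAt (by norm_num)).comp
      (f := fun y : E3 => (y, t)) x (by fun_prop)
  obtain ⟨h0, h1, hp⟩ := hax.angular_derivatives hNS.open_U hx hr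
    (fun j => (contDiff_apply_slice hu t j).differentiable (by norm_num) x) hP
  have ht : ∀ j, HasDerivAt (fun s => u x s j) (deriv (fun s => u x s j) t) t := fun j =>
    (((EuclideanSpace.proj j : E3 →L[ℝ] ℝ).contDiff.comp
      (hu.comp (contDiff_const.prodMk contDiff_id))).differentiable (by norm_num)
        t).hasDerivAt
  have hG : deriv (Gam u x) t = _ := (((ht 1).const_mul (x 0)).sub ((ht 0).const_mul (x 1))).deriv
  have m0 := hNS.momentum x t hx 0
  have m1 := hNS.momentum x t hx 1
  rw [lap_Gam hu, hG]
  simp only [(hasPd_Gam hu t _ x).2]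
  simp [Fin.sum_univ_three] at m0 m1 ⊢
  linear_combination (x 0 ^ 2 + x 1 ^ 2) * (x 0 * m1 - x 1 * m0 - hp) + 2 * x 0 * h0 + 2 * x 1 * h1

end SwirlEquation

theorem setIntegral_ball_eq_closedBall (f : E3 → ℝ) {R : ℝ} :
    ∫ x in Metric.ball 0 R, f x = ∫ x in Metric.closedBall 0 R, f x := by
  refine setIntegral_congr_set ?_
  have h := Measure.addHaar_sphere (volume : Measure E3) 0 R
  refine (ae_le_set.2 ?_).antisymm (ae_le_set.2 ?_)
  · simp [sdiff_eq_empty.2 Metric.ball_subset_closedBall]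
  · rwa [Metric.closedBall_sdiff_ball]

theorem AA_nonneg (u : E3 → ℝ → E3) (z : E3 × ℝ) {R : ℝ} (hR : 0 < R) : 0 ≤ AA u z R :=
  Real.iSup_nonneg fun _ => Real.iSup_nonneg fun _ => by positivity

theorem mem_closure_Qyl_of_mem {R : ℝ} (hR : 0 < R) (hR1 : R < 1) {x : E3} {t : ℝ}
    (hx : ‖x‖ ≤ R) (ht : t ∈ Ioo (-R ^ 2) 0) : (x, t) ∈ closure (Qyl (0, 0) 1) := by
  refine subset_closure ⟨by simpa using hx.trans_lt hR1, ?_, ht.2⟩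
  have := ht.1
  simp only
  nlinarith

theorem setIntegral_le_AA {u v : E3 → ℝ → E3} {R : ℝ} (hR : 0 < R)
    (hv : Continuous fun z : E3 × ℝ => v z.1 z.2)
    (huv : ∀ x t, ‖x‖ ≤ R → t ∈ Ioo (-R ^ 2) 0 → v x t = u x t) {t : ℝ}
    (ht : t ∈ Ioo (-R ^ 2) 0) :
    ∫ x in Metric.closedBall 0 R, ‖v x t‖ ^ 2 ≤ AA u (0, 0) R * R := by
  have hI : ∀ t ∈ Ioo (-R ^ 2) 0, ∫ x in Metric.ball 0 R, ‖u x t‖ ^ 2 =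
      ∫ x in Metric.closedBall 0 R, ‖v x t‖ ^ 2 := fun t ht => by
    rw [setIntegral_ball_eq_closedBall]
    refine setIntegral_congr_fun Metric.isClosed_closedBall.measurableSet fun x hx => ?_
    simp only [huv x t (by simpa using hx) ht]
  have hc : Continuous fun t => ∫ x in Metric.closedBall (0 : E3) R, ‖v x t‖ ^ 2 :=
    continuous_setIntegral_closedBall (f := fun x t => ‖v x t‖ ^ 2) (by fun_prop) R
  obtain ⟨B, hB⟩ := isCompact_Icc.bddAbove_image (K := Icc (-R ^ 2) 0) hc.continuousOn
  have hB' : ∀ t ∈ Ioo (-R ^ 2) 0, ∫ x in Metric.closedBall (0 : E3) R, ‖v x t‖ ^ 2 ≤ B :=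
    fun t ht => hB (mem_image_of_mem _ (Ioo_subset_Icc_self ht))
  have hB0 : 0 ≤ B := (by positivity : (0 : ℝ) ≤ _).trans (hB' t ht)
  have hbdd : BddAbove (range fun t => ⨆ _ : t ∈ Ioo (-R ^ 2) 0,
      R⁻¹ * ∫ x in Metric.ball (0 : E3) R, ‖u x t‖ ^ 2) := by
    refine ⟨R⁻¹ * B, ?_⟩
    rintro _ ⟨s, rfl⟩
    refine Real.iSup_le (fun hs => ?_) (by positivity)
    rw [hI s hs]
    gcongr
    exact hB' s hs
  have h : R⁻¹ * ∫ x in Metric.ball (0 : E3) R, ‖u x t‖ ^ 2 ≤ AA u (0, 0) R := by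
    simp only [AA, zero_sub]
    refine le_trans ?_ (le_ciSup hbdd t)
    rw [ciSup_pos ht]
  rw [hI t ht, inv_mul_le_iff₀ hR] at h
  linarith

theorem IsSwirl.neg {u : E3 → ℝ → E3} {G : E3 → ℝ → ℝ} {R A : ℝ} (h : IsSwirl u G R A) :
    IsSwirl u (fun x t => -G x t) R A := by
  have hp : ∀ (g : E3 → ℝ) i x, pd (fun y => -g y) i x = -pd g i x := fun g i x => by
    simp [pd, fderiv_fun_neg]
  have hl : ∀ (g : E3 → ℝ) x, lap (fun y => -g y) x = -lap g x := fun g x => by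
    simp only [lap, hp, Finset.sum_neg_distrib]
  refine ⟨h.smooth_u, h.smooth_G.neg, fun x t hx => by simp [h.axis x t hx], h.divfree,
    fun x t ht hx hr => ?_, h.A_nonneg, h.energy⟩
  have := h.pde x t ht hx hr
  rw [show (fun t => -G x t) = fun t => -(G x) t from rfl, deriv.fun_neg]
  simp only [hp, hl, mul_neg, Finset.sum_neg_distrib]
  linarith

theorem isSwirl_Gam {u v : E3 → ℝ → E3} {P : E3 → ℝ → ℝ} {W : Set (E3 × ℝ)} {R : ℝ} (hR : 0 < R)
    (hR1 : R < 1) (hv : ContDiff ℝ 2 fun z : E3 × ℝ => v z.1 z.2) (hNS : IsNSQ1 v P W)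
    (hax : IsAxisym v P W) (huv : ∀ x t, (x, t) ∈ W → v x t = u x t) :
    IsSwirl v (Gam v) R (AA u (0, 0) R) := by
  have hW : ∀ x t, ‖x‖ ≤ R → t ∈ Ioo (-R ^ 2) 0 → (x, t) ∈ W := fun x t hx ht =>
    hNS.subset_U (mem_closure_Qyl_of_mem hR hR1 hx ht)
  have hc : ∀ j, ContDiff ℝ 2 fun z : E3 × ℝ => v z.1 z.2 j := fun j =>
    (EuclideanSpace.proj j : E3 →L[ℝ] ℝ).contDiff.comp hv
  have hx : ∀ j, ContDiff ℝ 2 fun z : E3 × ℝ => z.1 j := fun j =>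
    (EuclideanSpace.proj j : E3 →L[ℝ] ℝ).contDiff.comp contDiff_fst
  refine ⟨hv.of_le (by norm_num), ((hx 0).mul (hc 1)).sub ((hx 1).mul (hc 0)), fun x t h => ?_,
    fun x t ht hx => hNS.divfree x t (hW x t hx.le ht),
    fun x t ht hx hr => swirl_equation hv hNS hax (hW x t hx.le ht) hr, AA_nonneg u _ hR,
    fun t ht => setIntegral_le_AA hR hv.continuous (fun x t hx ht => huv x t (hW x t hx ht)) ht⟩
  have h0 : x 0 = 0 := by nlinarith [sq_nonneg (x 0), sq_nonneg (x 1)]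
  have h1 : x 1 = 0 := by nlinarith [sq_nonneg (x 0), sq_nonneg (x 1)]
  simp [Gam, h0, h1]

theorem integral_truncEnergy_le {G H : E3 → ℝ → ℝ} {R : ℝ}
    (hG : Continuous fun z : E3 × ℝ => G z.1 z.2)
    (hGH : ∀ x t, ‖x‖ ≤ R → t ∈ Ioo (-R ^ 2) 0 → G x t ^ 2 = H x t ^ 2) :
    ∫ t in (-R ^ 2)..0, truncEnergy G R 0 t ≤
      ∫ t in Ioo (0 - R ^ 2) 0, ∫ x in Metric.ball 0 R, H x t ^ 2 := by
  have hc : Continuous fun t => ∫ x in Metric.closedBall (0 : E3) R, G x t ^ 2 :=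
    continuous_setIntegral_closedBall (f := fun x t => G x t ^ 2) (by fun_prop) R
  have hR : -R ^ 2 ≤ 0 := by nlinarith
  calc ∫ t in (-R ^ 2)..0, truncEnergy G R 0 t
      ≤ ∫ t in (-R ^ 2)..0, ∫ x in Metric.closedBall 0 R, G x t ^ 2 := by
        refine intervalIntegral.integral_mono_on hR
          ((continuous_truncEnergy hG R 0).intervalIntegrable _ _) (hc.intervalIntegrable _ _)
          fun t _ => ?_
        have hGt : Continuous fun x => G x t := hG.comp (by fun_prop : Continuous fun x => (x, t))
        refine setIntegral_mono_on ?_ ?_ Metric.isClosed_closedBall.measurableSet fun x _ => ?_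
        · exact ContinuousOn.integrableOn_compact (isCompact_closedBall 0 R) (by fun_prop)
        · exact ContinuousOn.integrableOn_compact (isCompact_closedBall 0 R) (by fun_prop)
        · rw [sub_zero, ← sq_abs (G x t)]
          exact pow_le_pow_left₀ (le_max_right _ _) (max_le (le_abs_self _) (abs_nonneg _)) 2
    _ = _ := by
      rw [intervalIntegral.integral_of_le hR, integral_Ioc_eq_integral_Ioo, zero_sub]
      refine setIntegral_congr_fun measurableSet_Ioo fun t ht => ?_
      simp only [setIntegral_ball_eq_closedBall]
      refine setIntegral_congr_fun Metric.isClosed_closedBall.measurableSet fun x hx => ?_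
      exact hGH x t (by simpa using hx) ht

/-- local maximum estimate for `Γ`. -/
theorem local_max_estimate :
    ∃ N : ℝ, ∀ (u : E3 → ℝ → E3) (P : E3 → ℝ → ℝ) (U : Set (E3 × ℝ)),
      IsNSQ1 u P U → IsAxisym u P U →
      ∀ R : ℝ, 0 < R → R < 1 →
      ∀ (x : E3) (t : ℝ), (x, t) ∈ Qyl (0, 0) (R/2) →
        |Gam u x t| ≤ N * ((1 + AA u (0, 0) R) / R) ^ ((5:ℝ)/2) *
          (∫ s in Ioo (0 - R ^ 2) (0:ℝ), ∫ y in Metric.ball (0:E3) R, (Gam u y s) ^ 2) ^ ((1:ℝ)/2) := by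
  obtain ⟨C, hC0, hC1⟩ := sobolev_inequality
  have hC : SobolevConst C := ⟨hC0, hC1⟩
  refine ⟨2 ^ 20 * (8 / 3) ^ 8 * stepConst C, fun u P U hNS hax R hR hR1 x t hxt => ?_⟩
  have hK : IsCompact (closure (Qyl (0, 0) 1)) :=
    (Metric.isBounded_ball.prod (Metric.isBounded_Ioo _ _)).isCompact_closure
  obtain ⟨w, W, hw, hWo, hQW, hWU, hwu⟩ :=
    hNS.smooth_u.exists_contDiff_eqOn hK hNS.open_U hNS.subset_U
  let v : E3 → ℝ → E3 := fun x t => w (x, t)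
  have huv : ∀ x t, (x, t) ∈ W → v x t = u x t := fun x t h => hwu h
  have hv : ContDiff ℝ 2 fun z : E3 × ℝ => v z.1 z.2 := mod_cast contDiff_infty.1 hw 2
  have hS := isSwirl_Gam hR hR1 hv (hNS.congr hWo hQW hWU huv) (hax.congr hWU huv) huv
  have hGW : ∀ x t, ‖x‖ ≤ R → t ∈ Ioo (-R ^ 2) 0 → Gam v x t = Gam u x t := fun x t hx ht => by
    simp only [Gam, huv x t (hQW (mem_closure_Qyl_of_mem hR hR1 hx ht))]
  have hx : ‖x‖ < R / 2 := by simpa using hxt.1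
  have ht : t ∈ Ioo (-(R / 2) ^ 2) 0 := by simpa using hxt.2
  have ht' : t ∈ Ioo (-R ^ 2) 0 := ⟨by nlinarith [ht.1], ht.2⟩
  have hA := AA_nonneg u (0, 0) hR
  have hq : 0 < (1 + AA u (0, 0) R) / R := by positivity
  set q := (1 + AA u (0, 0) R) / R
  have ha2 : √q ^ 2 = q := sq_sqrt hq.le
  have ha5 : √q ^ 5 = q ^ ((5 : ℝ) / 2) := by
    rw [sqrt_eq_rpow, ← rpow_natCast, ← rpow_mul hq.le]
    norm_num
  have ha4 : √q ^ 4 = q ^ 2 := by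
    rw [show √q ^ 4 = (√q ^ 2) ^ 2 by ring, ha2]
  have hN : 0 ≤ 2 ^ 20 * (8 / 3) ^ 8 * stepConst C * √q ^ 5 := by
    unfold stepConst
    positivity
  rw [← ha5, ← sqrt_eq_rpow, ← hGW x t (by linarith) ht']
  refine abs_le'.2 ⟨(hS.local_bound hC hR (sqrt_pos.2 hq) ha4 hx ht).trans ?_,
    (hS.neg.local_bound hC hR (sqrt_pos.2 hq) ha4 hx ht).trans ?_⟩
  · refine mul_le_mul_of_nonneg_left (sqrt_le_sqrt ?_) hN
    exact integral_truncEnergy_le hS.smooth_G.continuous fun x t hx ht => by rw [hGW x t hx ht]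
  · refine mul_le_mul_of_nonneg_left (sqrt_le_sqrt ?_) hN
    exact integral_truncEnergy_le hS.neg.smooth_G.continuous
      fun x t hx ht => by rw [neg_sq, hGW x t hx ht]
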